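/- arXiv:1207.5686 — 2 statements merged into one kernel-verified Lean document; each statement's English description precedes it below -/
import Mathlib

section
/- Let θ : ℝ → ℂ have a distributional derivative θ' with ∫_ℝ |θ(x)| e^{β|x|/2} dx < ∞, ∫_ℝ |θ'(x)| e^{β|x|/2} dx < ∞ and ∫_ℝ θ(x) dx = 0. Let k ∈ ℕ₀, let g ∈ ℰ_k, and let ζ ∈ ℂ with Re ζ > −k. Then there exists exactly one f ∈ ℰ_k satisfying ζf − 𝔏f − θ*f = g in the distributional sense, and its Fourier transform is given by f̂(ξ) = f̂₀(ξ) ∫_0^1 (ĝ(sξ)/f̂₀(sξ)) s^{ζ−1} ds for all ξ ∈ ℝ, where f̂₀(ξ) = exp(−ξ²/2 + ∫_0^1 θ̂(ξs)/s ds) and s^{ζ} = e^{ζ log s} with the natural logarithm on (0,1]. -/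
open MeasureTheory Complex
open scoped ContDiff

/-- Membership in `ℰ = L²(ℝ, cosh(βx) dx)`. -/
def memE (β : ℝ) (f : ℝ → ℂ) : Prop :=
  AEStronglyMeasurable f volume ∧
    Integrable (fun x : ℝ => ‖f x‖ ^ 2 * Real.cosh (β * x))

/-- Fourier transform with the paper's normalization, at a real frequency. -/
noncomputable def FT (f : ℝ → ℂ) (ξ : ℝ) : ℂ :=
  ∫ x : ℝ, f x * Complex.exp (-(Complex.I * x * ξ))

/-- `f'` is the distributional derivative of `f`. -/
def IsDistribDeriv (f f' : ℝ → ℂ) : Prop :=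
  ∀ φ : ℝ → ℂ, ContDiff ℝ ∞ φ → HasCompactSupport φ →
    ∫ x : ℝ, f x * deriv φ x = -∫ x : ℝ, f' x * φ x

/-- The convolution `(θ * f)(x) = ∫ θ(x−y) f(y) dy`. -/
noncomputable def conv (θ f : ℝ → ℂ) (x : ℝ) : ℂ := ∫ y : ℝ, θ (x - y) * f y

/-- `ζ f − 𝔏 f − θ*f = g` in the distributional sense. -/
def PerturbedResolventEq (θ : ℝ → ℂ) (ζ : ℂ) (f g : ℝ → ℂ) : Prop :=
  ∀ φ : ℝ → ℂ, ContDiff ℝ ∞ φ → HasCompactSupport φ →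
    ζ * (∫ x : ℝ, f x * φ x) - (∫ x : ℝ, f x * (deriv (deriv φ) x - x * deriv φ x))
      - (∫ x : ℝ, conv θ f x * φ x) = ∫ x : ℝ, g x * φ x

/-- `f̂₀(ξ) = exp(−ξ²/2 + ∫_0^1 θ̂(ξs)/s ds)`. -/
noncomputable def fhat0 (θ : ℝ → ℂ) (ξ : ℝ) : ℂ :=
  Complex.exp (-(ξ : ℂ) ^ 2 / 2 + ∫ s in (0:ℝ)..1, FT θ (ξ * s) / s)

namespace PerturbedFP

section

/-- The Fourier–Laplace transform, extending `FT` to complex frequencies. -/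
noncomputable def LT (f : ℝ → ℂ) (z : ℂ) : ℂ :=
  ∫ x : ℝ, f x * Complex.exp (-(Complex.I * x * z))

theorem LT_ofReal (f : ℝ → ℂ) (ξ : ℝ) : LT f (ξ : ℂ) = FT f ξ := rfl

/-- Integrability against `exp (c |x|)`. -/
def ExpInt (c : ℝ) (f : ℝ → ℂ) : Prop :=
  AEStronglyMeasurable f volume ∧ Integrable (fun x : ℝ => ‖f x‖ * Real.exp (c * |x|))

/-- The function whose transform is the derivative of the transform of `f`. -/
def mulNegI (f : ℝ → ℂ) (x : ℝ) : ℂ := -(I * x) * f x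

theorem norm_kernel (x : ℝ) (z : ℂ) :
    ‖Complex.exp (-(Complex.I * x * z))‖ = Real.exp (x * z.im) := by
  rw [Complex.norm_exp]; simp

theorem norm_kernel_le {c : ℝ} (x : ℝ) {z : ℂ} (hz : |z.im| ≤ c) :
    ‖Complex.exp (-(Complex.I * x * z))‖ ≤ Real.exp (c * |x|) := by
  rw [norm_kernel]
  apply Real.exp_le_exp.2
  calc x * z.im ≤ |x * z.im| := le_abs_self _
    _ = |z.im| * |x| := by rw [abs_mul, mul_comm]
    _ ≤ _ := by gcongr

theorem norm_kernel_real (x ξ : ℝ) : ‖Complex.exp (-(Complex.I * x * ξ))‖ = 1 := by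
  rw [norm_kernel]; simp

theorem continuous_kernel (z : ℂ) :
    Continuous (fun x : ℝ => Complex.exp (-(Complex.I * x * z))) := by fun_prop

theorem ExpInt.mono {c d : ℝ} {f : ℝ → ℂ} (h : ExpInt c f) (hd : d ≤ c) : ExpInt d f := by
  refine ⟨h.1, h.2.mono' ?_ ?_⟩
  · exact h.1.norm.mul (by fun_prop : Continuous fun x : ℝ => Real.exp (d * |x|)).aestronglyMeasurable
  · refine Filter.Eventually.of_forall fun x => ?_
    rw [Real.norm_of_nonneg (by positivity)]
    gcongr

theorem ExpInt.integrable {c : ℝ} {f : ℝ → ℂ} (h : ExpInt c f) (hc : 0 ≤ c) : Integrable f := by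
  have := (h.mono hc).2
  simp only [zero_mul, Real.exp_zero, mul_one] at this
  exact (integrable_norm_iff h.1).1 this

theorem ExpInt.integrable_kernel {c : ℝ} {f : ℝ → ℂ} (h : ExpInt c f) {z : ℂ} (hz : |z.im| ≤ c) :
    Integrable (fun x : ℝ => f x * Complex.exp (-(Complex.I * x * z))) := by
  refine h.2.mono' (h.1.mul (continuous_kernel z).aestronglyMeasurable) ?_
  refine Filter.Eventually.of_forall fun x => ?_
  rw [norm_mul]
  gcongr
  exact norm_kernel_le x hz

theorem ExpInt.norm_LT_le {c : ℝ} {f : ℝ → ℂ} (h : ExpInt c f) {z : ℂ} (hz : |z.im| ≤ c) :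
    ‖LT f z‖ ≤ ∫ x : ℝ, ‖f x‖ * Real.exp (c * |x|) := by
  refine norm_integral_le_of_norm_le h.2 (Filter.Eventually.of_forall fun x => ?_)
  rw [norm_mul]
  gcongr
  exact norm_kernel_le x hz

theorem ExpInt.pow_mul {c d : ℝ} {f : ℝ → ℂ} (h : ExpInt c f) (hd : d < c) (j : ℕ) :
    ExpInt d (fun x => f x * (x : ℂ) ^ j) := by
  have hmeas : AEStronglyMeasurable (fun x : ℝ => f x * (x : ℂ) ^ j) volume :=
    h.1.mul (by fun_prop : Continuous fun x : ℝ => (x : ℂ) ^ j).aestronglyMeasurable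
  refine ⟨hmeas, ?_⟩
  have hcd : 0 < c - d := sub_pos.2 hd
  refine (h.2.const_mul ((j.factorial : ℝ) / (c - d) ^ j)).mono' ?_ ?_
  · exact hmeas.norm.mul (by fun_prop : Continuous fun x : ℝ => Real.exp (d * |x|)).aestronglyMeasurable
  · refine Filter.Eventually.of_forall fun x => ?_
    rw [Real.norm_of_nonneg (by positivity), norm_mul, norm_pow, Complex.norm_real, Real.norm_eq_abs]
    have h1 := Real.pow_div_factorial_le_exp ((c - d) * |x|) (by positivity) j
    have h2 : |x| ^ j ≤ (j.factorial : ℝ) / (c - d) ^ j * Real.exp ((c - d) * |x|) := by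
      rw [mul_pow] at h1
      have hf : (0 : ℝ) < j.factorial := by positivity
      rw [div_le_iff₀ hf] at h1
      rw [div_mul_eq_mul_div, le_div_iff₀ (by positivity)]
      linarith
    have h3 : Real.exp (c * |x|) = Real.exp ((c - d) * |x|) * Real.exp (d * |x|) := by
      rw [← Real.exp_add]; ring_nf
    rw [h3]
    calc ‖f x‖ * |x| ^ j * Real.exp (d * |x|)
        ≤ ‖f x‖ * ((j.factorial : ℝ) / (c - d) ^ j * Real.exp ((c - d) * |x|))
          * Real.exp (d * |x|) := by gcongr
      _ = _ := by ring

theorem ExpInt.mulNegI {c d : ℝ} {f : ℝ → ℂ} (h : ExpInt c f) (hd : d < c) :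
    ExpInt d (mulNegI f) := by
  obtain ⟨h1, h2⟩ := h.pow_mul hd 1
  refine ⟨?_, ?_⟩
  · convert h1.const_mul (-I) using 2 with x
    simp only [PerturbedFP.mulNegI]; ring
  · convert h2 using 3 with x
    simp [PerturbedFP.mulNegI, mul_comm]

theorem integrable_exp_neg_mul_abs {b : ℝ} (hb : 0 < b) :
    Integrable (fun x : ℝ => Real.exp (-b * |x|)) := by
  rw [← integrableOn_univ, ← Set.Iic_union_Ioi (a := (0 : ℝ))]
  refine IntegrableOn.union ?_ ?_
  · refine (integrableOn_exp_mul_Iic hb 0).congr_fun (fun x hx => ?_) measurableSet_Iic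
    simp [abs_of_nonpos (Set.mem_Iic.1 hx)]
  · refine (integrableOn_exp_mul_Ioi (neg_lt_zero.2 hb) 0).congr_fun (fun x hx => ?_)
      measurableSet_Ioi
    simp [abs_of_pos (Set.mem_Ioi.1 hx)]

theorem expInt_of_memE {β : ℝ} {f : ℝ → ℂ} (h : memE β f) {c : ℝ} (hc : c < β / 2) :
    ExpInt c f := by
  have hb : 0 < β - 2 * c := by linarith
  refine ⟨h.1, ?_⟩
  have hint : Integrable (fun x : ℝ => Real.exp (-(β - 2 * c) * |x|)) :=
    integrable_exp_neg_mul_abs hb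
  refine (h.2.add (hint.const_mul 2)).mono' ?_ ?_
  · exact h.1.norm.mul (by fun_prop : Continuous fun x : ℝ => Real.exp (c * |x|)).aestronglyMeasurable
  · refine Filter.Eventually.of_forall fun x => ?_
    rw [Real.norm_of_nonneg (by positivity)]
    simp only [Pi.add_apply]
    have hcosh : Real.exp (β * |x|) / 2 ≤ Real.cosh (β * x) := by
      rw [← Real.cosh_abs, abs_mul]
      have : Real.exp (β * |x|) ≤ Real.exp (|β| * |x|) := by
        gcongr; exact le_abs_self _
      rw [Real.cosh_eq]
      have := Real.exp_pos (-(|β| * |x|))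
      linarith
    have e1 : Real.exp (β * |x|) = Real.exp (β / 2 * |x|) ^ 2 := by
      rw [← Real.exp_nat_mul]; congr 1; push_cast; ring
    have e2 : Real.exp (-(β - 2 * c) * |x|) = Real.exp (-(β/2 - c) * |x|) ^ 2 := by
      rw [← Real.exp_nat_mul]; congr 1; push_cast; ring
    have e3 : Real.exp (c * |x|) = Real.exp (β / 2 * |x|) * Real.exp (-(β/2 - c) * |x|) := by
      rw [← Real.exp_add]; ring_nf
    rw [e2, e3]
    have h4 : ‖f x‖ ^ 2 * (Real.exp (β / 2 * |x|) ^ 2 / 2) ≤ ‖f x‖ ^ 2 * Real.cosh (β * x) := by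
      rw [← e1]; gcongr
    nlinarith [sq_nonneg (‖f x‖ * Real.exp (β / 2 * |x|) - Real.exp (-(β/2 - c) * |x|)),
      sq_nonneg (Real.exp (-(β/2 - c) * |x|))]

theorem ExpInt.hasDerivAt_LT {c : ℝ} {f : ℝ → ℂ} (h : ExpInt c f) {z : ℂ} (hz : |z.im| < c) :
    HasDerivAt (LT f) (LT (PerturbedFP.mulNegI f) z) z := by
  obtain ⟨d, hd1, hd2⟩ := exists_between hz
  have hS : {w : ℂ | |w.im| < d} ∈ nhds z :=
    (isOpen_lt (by fun_prop) continuous_const).mem_nhds hd1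
  have hm := h.mulNegI hd2
  refine (hasDerivAt_integral_of_dominated_loc_of_deriv_le
    (F := fun (z : ℂ) (x : ℝ) => f x * Complex.exp (-(Complex.I * x * z)))
    (F' := fun (z : ℂ) (x : ℝ) => PerturbedFP.mulNegI f x * Complex.exp (-(Complex.I * x * z)))
    (bound := fun x => ‖PerturbedFP.mulNegI f x‖ * Real.exp (d * |x|)) hS ?_ ?_ ?_ ?_ hm.2 ?_).2
  · exact Filter.Eventually.of_forall fun w =>
      h.1.mul (continuous_kernel w).aestronglyMeasurable
  · exact h.integrable_kernel hz.le
  · exact hm.1.mul (continuous_kernel z).aestronglyMeasurable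
  · refine Filter.Eventually.of_forall fun x w hw => ?_
    rw [norm_mul]
    gcongr
    exact norm_kernel_le x (le_of_lt hw)
  · refine Filter.Eventually.of_forall fun x w hw => ?_
    have h1 : HasDerivAt (fun w : ℂ => -(Complex.I * x * w)) (-(Complex.I * x * 1)) w :=
      ((hasDerivAt_id w).const_mul _).neg
    have h2 := h1.cexp.const_mul (f x)
    refine h2.congr_deriv ?_
    simp only [PerturbedFP.mulNegI]; ring

/-- Taylor expansion of the transform at the origin. -/
theorem ExpInt.exists_norm_LT_sub_sum_le {c : ℝ} (hc : 0 < c) {f : ℝ → ℂ} (h : ExpInt c f) (k : ℕ) :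
    ∃ B : ℝ, 0 ≤ B ∧ ∀ z : ℂ, ‖z‖ ≤ c / 2 → ‖LT f z - ∑ j ∈ Finset.range k,
      (∫ x : ℝ, f x * (x : ℂ) ^ j) * ((-(Complex.I * z)) ^ j / (j.factorial : ℂ))‖
        ≤ B * ‖z‖ ^ k := by
  refine ⟨∫ x : ℝ, ‖f x * (x : ℂ) ^ k‖ * Real.exp (c / 2 * |x|),
    integral_nonneg fun x => by positivity, fun z hzc => ?_⟩
  have hz : |z.im| ≤ c := (Complex.abs_im_le_norm z).trans (hzc.trans (half_le_self hc.le))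
  have hk := h.pow_mul (half_lt_self hc) k
  have hpt : ∀ (j : ℕ) (x : ℝ), f x * ((-(Complex.I * x * z)) ^ j / (j.factorial : ℂ))
      = f x * (x : ℂ) ^ j * ((-(Complex.I * z)) ^ j / (j.factorial : ℂ)) := fun j x => by
    rw [show -(Complex.I * x * z) = x * (-(Complex.I * z)) by ring, mul_pow]; ring
  have hi : ∀ j ∈ Finset.range k, Integrable (fun x : ℝ =>
      f x * ((-(Complex.I * x * z)) ^ j / (j.factorial : ℂ))) := fun j _ => by
    simp only [hpt]
    exact ((h.pow_mul hc j).integrable le_rfl).mul_const _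
  have hpoly : LT f z - ∑ j ∈ Finset.range k,
      (∫ x : ℝ, f x * (x : ℂ) ^ j) * ((-(Complex.I * z)) ^ j / (j.factorial : ℂ))
      = ∫ x : ℝ, f x * (Complex.exp (-(Complex.I * x * z))
        - ∑ j ∈ Finset.range k, (-(Complex.I * x * z)) ^ j / (j.factorial : ℂ)) := by
    simp_rw [mul_sub, Finset.mul_sum]
    rw [integral_sub (h.integrable_kernel hz) (integrable_finsetSum _ hi), integral_finsetSum _ hi]
    simp only [hpt, integral_mul_const]
    rfl
  rw [hpoly, ← integral_mul_const]
  refine norm_integral_le_of_norm_le (hk.2.mul_const _) (Filter.Eventually.of_forall fun x => ?_)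
  rw [norm_mul]
  have h1 := Complex.norm_exp_sub_sum_le_norm_mul_exp (-(Complex.I * x * z)) k
  have h2 : ‖-(Complex.I * x * z)‖ = |x| * ‖z‖ := by simp
  rw [h2] at h1
  have h3 : Real.exp (|x| * ‖z‖) ≤ Real.exp (c / 2 * |x|) := by
    rw [mul_comm]; gcongr
  calc _ ≤ ‖f x‖ * ((|x| * ‖z‖) ^ k * Real.exp (c / 2 * |x|)) := by
        gcongr; exact h1.trans (by gcongr)
    _ = _ := by simp; ring

theorem ExpInt.norm_LT_le_pow {c : ℝ} (hc : 0 < c) {f : ℝ → ℂ} (h : ExpInt c f) (k : ℕ)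
    (hmom : ∀ j < k, ∫ x : ℝ, f x * (x : ℂ) ^ j = 0) :
    ∃ C : ℝ, 0 ≤ C ∧ ∀ z : ℂ, |z.im| ≤ c → ‖LT f z‖ ≤ C * ‖z‖ ^ k := by
  set A := ∫ x : ℝ, ‖f x‖ * Real.exp (c * |x|)
  have hA : 0 ≤ A := integral_nonneg fun x => by positivity
  obtain ⟨B, hB, hle⟩ := h.exists_norm_LT_sub_sum_le hc k
  refine ⟨A / (c / 2) ^ k + B, by positivity, fun z hz => ?_⟩
  by_cases hzc : ‖z‖ ≤ c / 2
  · have h1 := hle z hzc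
    rw [Finset.sum_eq_zero fun j hj => by rw [hmom j (Finset.mem_range.1 hj), zero_mul],
      sub_zero] at h1
    refine h1.trans ?_
    gcongr
    have : 0 ≤ A / (c / 2) ^ k := by positivity
    linarith
  · push Not at hzc
    have h1 := h.norm_LT_le hz
    have h2 : A ≤ A / (c / 2) ^ k * ‖z‖ ^ k := by
      rw [div_mul_eq_mul_div, le_div_iff₀ (by positivity)]
      gcongr
    calc _ ≤ A := h1
      _ ≤ _ := h2
      _ ≤ _ := by gcongr; linarith

/-- The order of vanishing of the transform at the origin controls the moments. -/
theorem ExpInt.moments_eq_zero {c : ℝ} (hc : 0 < c) {f : ℝ → ℂ} (h : ExpInt c f) {k : ℕ} {C : ℝ}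
    (hf : ∀ ξ : ℝ, 0 < ξ → ξ ≤ 1 → ‖FT f ξ‖ ≤ C * ξ ^ k) :
    ∀ j < k, ∫ x : ℝ, f x * (x : ℂ) ^ j = 0 := by
  intro j
  induction j using Nat.strong_induction_on with
  | _ j ih =>
  intro hj
  obtain ⟨B, hB, hle⟩ := h.exists_norm_LT_sub_sum_le hc (j + 1)
  set m := ∫ x : ℝ, f x * (x : ℂ) ^ j
  have hC : 0 ≤ C := by
    have := (norm_nonneg _).trans (hf 1 one_pos le_rfl)
    simpa using this
  have hsmall : ∀ ξ : ℝ, 0 < ξ → ξ ≤ min 1 (c / 2) → ‖m‖ / j.factorial ≤ (C + B) * ξ := by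
    intro ξ h0 h1
    have h2 := hf ξ h0 (h1.trans (min_le_left _ _))
    have hn : ‖(ξ : ℂ)‖ = ξ := by rw [Complex.norm_real, Real.norm_of_nonneg h0.le]
    have h3 := hle ξ (by rw [hn]; exact h1.trans (min_le_right _ _))
    rw [Finset.sum_range_succ, Finset.sum_eq_zero fun i hi => by
      rw [ih i (Finset.mem_range.1 hi) ((Finset.mem_range.1 hi).trans hj), zero_mul], zero_add,
      LT_ofReal, hn] at h3
    have h4 : ‖m * ((-(Complex.I * ξ)) ^ j / (j.factorial : ℂ))‖ = ‖m‖ / j.factorial * ξ ^ j := by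
      rw [norm_mul, norm_div, norm_pow, norm_neg, norm_mul, Complex.norm_I, hn, one_mul,
        Complex.norm_natCast]
      ring
    have h5 : ‖m‖ / j.factorial * ξ ^ j ≤ (C + B) * ξ * ξ ^ j := by
      rw [← h4]
      have h6 := norm_sub_norm_le (m * ((-(Complex.I * ξ)) ^ j / (j.factorial : ℂ))) (FT f ξ)
      rw [norm_sub_rev] at h6
      have h7 : ξ ^ k ≤ ξ ^ (j + 1) := pow_le_pow_of_le_one h0.le (h1.trans (min_le_left _ _)) hj
      calc _ ≤ C * ξ ^ k + B * ξ ^ (j + 1) := by linarith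
        _ ≤ C * ξ ^ (j + 1) + B * ξ ^ (j + 1) := by gcongr
        _ = _ := by ring
    exact le_of_mul_le_mul_right h5 (pow_pos h0 j)
  have hlim : Filter.Tendsto (fun ξ : ℝ => (C + B) * ξ) (nhdsWithin 0 (Set.Ioi 0)) (nhds 0) := by
    have : Continuous fun ξ : ℝ => (C + B) * ξ := by fun_prop
    simpa using (this.tendsto 0).mono_left nhdsWithin_le_nhds
  have hpos : 0 < min 1 (c / 2) := by positivity
  have h0 : ‖m‖ / j.factorial ≤ 0 := ge_of_tendsto hlim <|
    Filter.mem_of_superset (Ioc_mem_nhdsGT hpos) fun ξ hξ => hsmall ξ hξ.1 hξ.2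
  rw [div_le_iff₀ (by positivity), zero_mul] at h0
  exact norm_le_zero_iff.1 h0

end

section

/-- The exponent `∫₀¹ θ̂(zs)/s ds` at complex frequencies. -/
noncomputable def logFactor (θ : ℝ → ℂ) (z : ℂ) : ℂ := ∫ s in (0:ℝ)..1, LT θ (z * s) / s

/-- The extension of `fhat0` to complex frequencies. -/
noncomputable def cfhat0 (θ : ℝ → ℂ) (z : ℂ) : ℂ := Complex.exp (-z ^ 2 / 2 + logFactor θ z)

theorem cfhat0_ofReal (θ : ℝ → ℂ) (ξ : ℝ) : cfhat0 θ ξ = fhat0 θ ξ := by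
  simp [cfhat0, fhat0, logFactor, ← LT_ofReal]

theorem cfhat0_ne_zero (θ : ℝ → ℂ) (z : ℂ) : cfhat0 θ z ≠ 0 := Complex.exp_ne_zero _

theorem abs_im_mul_le (z : ℂ) {s : ℝ} (h0 : 0 ≤ s) (h1 : s ≤ 1) : |(z * s).im| ≤ |z.im| := by
  simp only [mul_im, ofReal_re, ofReal_im, mul_zero, zero_add, abs_mul, abs_of_nonneg h0]
  exact mul_le_of_le_one_right (abs_nonneg _) h1

theorem ExpInt.continuousOn_LT_ray {c : ℝ} {f : ℝ → ℂ} (h : ExpInt c f) {z : ℂ} (hz : |z.im| < c) :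
    ContinuousOn (fun s : ℝ => LT f (z * s)) (Set.Icc 0 1) := by
  intro s hs
  have h1 := (h.hasDerivAt_LT ((abs_im_mul_le z hs.1 hs.2).trans_lt hz)).continuousAt
  exact (ContinuousAt.comp (f := fun s : ℝ => z * s) h1 (by fun_prop)).continuousWithinAt

theorem ExpInt.LT_zero {f : ℝ → ℂ} (h0 : ∫ x : ℝ, f x = 0) : LT f 0 = 0 := by
  simp [LT, h0]

variable {b : ℝ} {θ : ℝ → ℂ}

theorem exists_norm_LT_le (hb : 0 < b) (hθ : ExpInt b θ) (h0 : ∫ x : ℝ, θ x = 0) :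
    ∃ C : ℝ, 0 ≤ C ∧ ∀ z : ℂ, |z.im| ≤ b → ‖LT θ z‖ ≤ C * ‖z‖ := by
  obtain ⟨C, hC, h⟩ := hθ.norm_LT_le_pow hb 1 (by intro j hj; simp [Nat.lt_one_iff.1 hj, h0])
  exact ⟨C, hC, by simpa using h⟩

theorem intervalIntegrable_LT_div (hb : 0 < b) (hθ : ExpInt b θ) (h0 : ∫ x : ℝ, θ x = 0)
    {z : ℂ} (hz : |z.im| < b) :
    IntervalIntegrable (fun s : ℝ => LT θ (z * s) / s) volume 0 1 := by
  obtain ⟨C, hC, h⟩ := exists_norm_LT_le hb hθ h0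
  rw [intervalIntegrable_iff_integrableOn_Ioo_of_le zero_le_one]
  have hm : AEStronglyMeasurable (fun s : ℝ => LT θ (z * s) / s)
      (volume.restrict (Set.Ioo (0:ℝ) 1)) := by
    refine ContinuousOn.aestronglyMeasurable ?_ measurableSet_Ioo
    refine ((hθ.continuousOn_LT_ray hz).mono Set.Ioo_subset_Icc_self).div (by fun_prop) ?_
    intro s hs
    exact_mod_cast hs.1.ne'
  refine Integrable.of_bound hm (C * ‖z‖) ?_
  filter_upwards [ae_restrict_mem measurableSet_Ioo] with s hs
  have h2 := h (z * s) ((abs_im_mul_le z hs.1.le hs.2.le).trans hz.le)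
  rw [norm_div, norm_real, Real.norm_of_nonneg hs.1.le, div_le_iff₀ hs.1]
  simpa [abs_of_pos hs.1, mul_assoc] using h2

theorem hasDerivAt_logFactor (hb : 0 < b) (hθ : ExpInt b θ) (h0 : ∫ x : ℝ, θ x = 0)
    {z : ℂ} (hz : |z.im| < b) :
    HasDerivAt (logFactor θ) (∫ s in (0:ℝ)..1, LT (mulNegI θ) (z * s)) z := by
  obtain ⟨d, hd1, hd2⟩ := exists_between hz
  have hS : {w : ℂ | |w.im| < d} ∈ nhds z :=
    (isOpen_lt (by fun_prop) continuous_const).mem_nhds hd1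
  have hm := hθ.mulNegI hd2
  have hmeas : ∀ w : ℂ, |w.im| < b → AEStronglyMeasurable (fun s : ℝ => LT θ (w * s) / s)
      (volume.restrict (Set.uIoc (0:ℝ) 1)) := fun w hw =>
    (intervalIntegrable_iff.1 (intervalIntegrable_LT_div hb hθ h0 hw)).aestronglyMeasurable
  refine (intervalIntegral.hasDerivAt_integral_of_dominated_loc_of_deriv_le
    (F := fun (z : ℂ) (s : ℝ) => LT θ (z * s) / s)
    (F' := fun (z : ℂ) (s : ℝ) => LT (mulNegI θ) (z * s))
    (bound := fun _ => ∫ x : ℝ, ‖mulNegI θ x‖ * Real.exp (d * |x|)) hS ?_ ?_ ?_ ?_ ?_ ?_).2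
  · filter_upwards [hS] with w hw
    exact hmeas w (lt_trans hw hd2)
  · exact intervalIntegrable_LT_div hb hθ h0 hz
  · rw [Set.uIoc_of_le zero_le_one]
    exact ((hm.continuousOn_LT_ray hd1).mono Set.Ioc_subset_Icc_self).aestronglyMeasurable
      measurableSet_Ioc
  · refine Filter.Eventually.of_forall fun s hs w hw => ?_
    rw [Set.uIoc_of_le zero_le_one] at hs
    exact hm.norm_LT_le ((abs_im_mul_le w hs.1.le hs.2).trans (le_of_lt hw))
  · exact intervalIntegrable_const
  · refine Filter.Eventually.of_forall fun s hs w hw => ?_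
    rw [Set.uIoc_of_le zero_le_one] at hs
    have h1 := hθ.hasDerivAt_LT (((abs_im_mul_le w hs.1.le hs.2).trans_lt hw).trans hd2)
    have h2 : HasDerivAt (fun w : ℂ => w * s) (1 * s) w := (hasDerivAt_id w).mul_const _
    have h3 := (h1.comp w h2).div_const (s : ℂ)
    refine h3.congr_deriv ?_
    have : (s : ℂ) ≠ 0 := by exact_mod_cast hs.1.ne'
    field_simp

theorem mul_integral_LT_mulNegI (hθ : ExpInt b θ) (h0 : ∫ x : ℝ, θ x = 0)
    {z : ℂ} (hz : |z.im| < b) :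
    z * ∫ s in (0:ℝ)..1, LT (mulNegI θ) (z * s) = LT θ z := by
  obtain ⟨d, hd1, hd2⟩ := exists_between hz
  have hm := hθ.mulNegI hd2
  rw [← intervalIntegral.integral_const_mul]
  rw [intervalIntegral.integral_eq_sub_of_hasDerivAt (f := fun s : ℝ => LT θ (z * s))]
  · simp [ExpInt.LT_zero h0]
  · intro s hs
    rw [Set.uIcc_of_le zero_le_one] at hs
    have h1 := hθ.hasDerivAt_LT ((abs_im_mul_le z hs.1 hs.2).trans_lt hz)
    have h2 : HasDerivAt (fun w : ℂ => z * w) (z * 1) (s : ℂ) := (hasDerivAt_id _).const_mul _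
    have h3 := (HasDerivAt.comp (s : ℂ) h1 h2).comp_ofReal
    refine h3.congr_deriv ?_
    ring
  · refine ContinuousOn.intervalIntegrable ?_
    rw [Set.uIcc_of_le zero_le_one]
    exact (hm.continuousOn_LT_ray hd1).const_mul _

theorem hasDerivAt_cfhat0 (hb : 0 < b) (hθ : ExpInt b θ) (h0 : ∫ x : ℝ, θ x = 0)
    {z : ℂ} (hz : |z.im| < b) :
    HasDerivAt (cfhat0 θ)
      (cfhat0 θ z * (-z + ∫ s in (0:ℝ)..1, LT (mulNegI θ) (z * s))) z := by
  have h1 : HasDerivAt (fun z : ℂ => -z ^ 2 / 2) (-z) z := by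
    refine ((hasDerivAt_pow 2 z).neg.div_const 2).congr_deriv ?_
    push_cast; ring
  exact (h1.add (hasDerivAt_logFactor hb hθ h0 hz)).cexp

theorem logFactor_sub (hb : 0 < b) (hθ : ExpInt b θ) (h0 : ∫ x : ℝ, θ x = 0)
    {z : ℂ} (hz : |z.im| < b) {s : ℝ} (hs0 : 0 < s) (hs1 : s ≤ 1) :
    logFactor θ z - logFactor θ (z * s) = ∫ t in s..1, LT θ (z * t) / t := by
  have hi := intervalIntegrable_LT_div hb hθ h0 hz
  have h1 : logFactor θ (z * s) = ∫ t in (0:ℝ)..s, LT θ (z * t) / t := by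
    have h2 := intervalIntegral.smul_integral_comp_mul_left (a := 0) (b := 1)
      (fun t : ℝ => LT θ (z * t) / t) s
    rw [mul_zero, mul_one] at h2
    rw [← h2, logFactor, ← intervalIntegral.integral_smul]
    refine intervalIntegral.integral_congr fun t _ => ?_
    have : (s : ℂ) ≠ 0 := by exact_mod_cast hs0.ne'
    simp only [real_smul, ofReal_mul, ← mul_assoc]
    rw [mul_div_assoc', mul_div_mul_left _ _ this]
  rw [h1, logFactor]
  rw [intervalIntegral.integral_interval_sub_left hi]
  refine hi.mono_set ?_
  rw [Set.uIcc_of_le zero_le_one, Set.uIcc_of_le hs0.le]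
  exact Set.Icc_subset_Icc_right hs1

theorem exists_norm_logFactor_sub_le (hb : 0 < b) (hθ : ExpInt b θ) (h0 : ∫ x : ℝ, θ x = 0) :
    ∃ C : ℝ, 0 ≤ C ∧ ∀ z : ℂ, |z.im| < b → ∀ s : ℝ, 0 < s → s ≤ 1 →
      ‖logFactor θ z - logFactor θ (z * s)‖ ≤ C * ‖z‖ := by
  obtain ⟨C, hC, h⟩ := exists_norm_LT_le hb hθ h0
  refine ⟨C, hC, fun z hz s hs0 hs1 => ?_⟩
  rw [logFactor_sub hb hθ h0 hz hs0 hs1]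
  refine (intervalIntegral.norm_integral_le_of_norm_le_const (C := C * ‖z‖) fun t ht => ?_).trans ?_
  · rw [Set.uIoc_of_le hs1] at ht
    have ht0 : 0 < t := hs0.trans ht.1
    have h2 := h (z * t) ((abs_im_mul_le z ht0.le ht.2).trans hz.le)
    rw [norm_div, norm_real, Real.norm_of_nonneg ht0.le, div_le_iff₀ ht0]
    simpa [abs_of_pos ht0, mul_assoc] using h2
  · rw [abs_of_nonneg (by linarith)]
    exact mul_le_of_le_one_right (by positivity) (by linarith)

theorem exists_norm_logFactor_sub_le_const (hb : 0 < b) (hθ : ExpInt b θ)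
    (h0 : ∫ x : ℝ, θ x = 0) :
    ∃ C : ℝ, 0 ≤ C ∧ ∀ z : ℂ, |z.im| < b → ∀ s : ℝ, 1 / 2 ≤ s → s ≤ 1 →
      ‖logFactor θ z - logFactor θ (z * s)‖ ≤ C := by
  set A := ∫ x : ℝ, ‖θ x‖ * Real.exp (b * |x|)
  have hA : 0 ≤ A := integral_nonneg fun x => by positivity
  refine ⟨A * 2, by positivity, fun z hz s hs0 hs1 => ?_⟩
  rw [logFactor_sub hb hθ h0 hz (by linarith) hs1]
  refine (intervalIntegral.norm_integral_le_of_norm_le_const (C := A * 2) fun t ht => ?_).trans ?_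
  · rw [Set.uIoc_of_le hs1] at ht
    have ht0 : 1 / 2 < t := hs0.trans_lt ht.1
    have h2 := hθ.norm_LT_le (z := z * t) ((abs_im_mul_le z (by linarith) ht.2).trans hz.le)
    rw [norm_div, norm_real, Real.norm_of_nonneg (by linarith), div_le_iff₀ (by linarith)]
    refine h2.trans ?_
    nlinarith
  · rw [abs_of_nonneg (by linarith)]
    exact mul_le_of_le_one_right (by positivity) (by linarith)

end

section

open FourierTransform SchwartzMap
open scoped ENNReal

theorem integrable_mul_kernel {f : ℝ → ℂ} (hf : Integrable f) (ξ : ℝ) :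
    Integrable (fun x : ℝ => f x * Complex.exp (-(I * x * ξ))) := by
  refine hf.mul_bdd (c := 1) (continuous_kernel ξ).aestronglyMeasurable ?_
  exact Filter.Eventually.of_forall fun x => (norm_kernel_real x ξ).le

theorem norm_FT_le (f : ℝ → ℂ) (ξ : ℝ) : ‖FT f ξ‖ ≤ ∫ x : ℝ, ‖f x‖ := by
  refine (norm_integral_le_integral_norm _).trans_eq ?_
  simp only [norm_mul, norm_kernel_real, mul_one]

theorem continuous_FT {f : ℝ → ℂ} (hf : Integrable f) : Continuous (FT f) := by
  refine continuous_of_dominated (F := fun (ξ : ℝ) (x : ℝ) => f x * Complex.exp (-(I * x * ξ)))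
    (bound := fun x => ‖f x‖) ?_ ?_ hf.norm ?_
  · exact fun ξ => (integrable_mul_kernel hf ξ).aestronglyMeasurable
  · exact fun ξ => Filter.Eventually.of_forall fun x => by rw [norm_mul, norm_kernel_real, mul_one]
  · exact Filter.Eventually.of_forall fun x => by fun_prop

theorem hasDerivAt_FT {f : ℝ → ℂ} (hf : Integrable f) (hm : Integrable (mulNegI f)) (ξ : ℝ) :
    HasDerivAt (FT f) (FT (mulNegI f) ξ) ξ := by
  refine (hasDerivAt_integral_of_dominated_loc_of_deriv_le
    (F := fun (ξ : ℝ) (x : ℝ) => f x * Complex.exp (-(I * x * ξ)))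
    (F' := fun (ξ : ℝ) (x : ℝ) => mulNegI f x * Complex.exp (-(I * x * ξ)))
    (bound := fun x => ‖mulNegI f x‖) Filter.univ_mem ?_ ?_ ?_ ?_ hm.norm ?_).2
  · exact Filter.Eventually.of_forall fun w => (integrable_mul_kernel hf w).aestronglyMeasurable
  · exact integrable_mul_kernel hf ξ
  · exact (integrable_mul_kernel hm ξ).aestronglyMeasurable
  · exact Filter.Eventually.of_forall fun x w _ => by rw [norm_mul, norm_kernel_real, mul_one]
  · refine Filter.Eventually.of_forall fun x w _ => ?_
    have h1 : HasDerivAt (fun w : ℂ => -(I * x * w)) (-(I * x * 1)) (w : ℂ) :=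
      ((hasDerivAt_id _).const_mul _).neg
    have h2 := (h1.cexp.const_mul (f x)).comp_ofReal
    refine h2.congr_deriv ?_
    simp only [mulNegI]; ring

theorem FT_eq_fourier (f : ℝ → ℂ) (ξ : ℝ) : FT f ξ = 𝓕 f (ξ / (2 * Real.pi)) := by
  rw [Real.fourier_real_eq_integral_exp_smul]
  unfold FT
  congr 1; ext x
  rw [smul_eq_mul, mul_comm]
  congr 2
  have : (Real.pi : ℂ) ≠ 0 := by exact_mod_cast Real.pi_ne_zero
  push_cast
  field_simp

theorem integral_mul_FT {f ψ : ℝ → ℂ} (hf : Integrable f) (hψ : Integrable ψ) :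
    ∫ x : ℝ, f x * FT ψ x = ∫ ξ : ℝ, FT f ξ * ψ ξ := by
  have h1 : ∀ x : ℝ, f x * FT ψ x = ∫ ξ : ℝ, f x * ψ ξ * Complex.exp (-(I * x * ξ)) := fun x => by
    rw [FT, ← integral_const_mul]
    congr 1; ext ξ
    rw [mul_right_comm I (x : ℂ) (ξ : ℂ)]; ring
  have h2 : ∀ ξ : ℝ, FT f ξ * ψ ξ = ∫ x : ℝ, f x * ψ ξ * Complex.exp (-(I * x * ξ)) := fun ξ => by
    rw [FT, ← integral_mul_const]
    congr 1; ext x; ring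
  simp_rw [h1, h2]
  refine integral_integral_swap ?_
  refine (hf.mul_prod hψ).mul_bdd (c := 1) ?_ ?_
  · exact (by fun_prop : Continuous fun p : ℝ × ℝ =>
      Complex.exp (-(I * p.1 * p.2))).aestronglyMeasurable
  · exact Filter.Eventually.of_forall fun p => (norm_kernel_real p.1 p.2).le

/-- A test function is the transform of a function with two integrable moments. -/
theorem exists_eq_FT {φ : ℝ → ℂ} (hφ : ContDiff ℝ ∞ φ) (hc : HasCompactSupport φ) :
    ∃ ψ : ℝ → ℂ, Integrable ψ ∧ Integrable (mulNegI ψ) ∧ Integrable (mulNegI (mulNegI ψ)) ∧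
      φ = FT ψ := by
  have hpi : 2 * Real.pi ≠ 0 := by positivity
  set Ψ : 𝓢(ℝ, ℂ) := 𝓕⁻ (hc.toSchwartzMap hφ) with hΨ
  have hint : ∀ j : ℕ, Integrable (fun x : ℝ => (x : ℂ) ^ j * Ψ x) := fun j => by
    refine (integrable_norm_iff (by fun_prop)).1 ?_
    refine (SchwartzMap.integrable_pow_mul volume Ψ j).congr
      (Filter.Eventually.of_forall fun x => ?_)
    simp
  have hint' : ∀ j : ℕ, ∀ c : ℂ,
      Integrable (fun x : ℝ => c * ((x : ℂ) ^ j * Ψ (x / (2 * Real.pi)))) := fun j c => by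
    refine (((hint j).comp_div hpi).const_mul (c * (2 * Real.pi) ^ j)).congr
      (Filter.Eventually.of_forall fun x => ?_)
    have : (2 * Real.pi : ℂ) ≠ 0 := by exact_mod_cast hpi
    simp only [ofReal_div, ofReal_mul, ofReal_ofNat, div_pow]
    field_simp
  refine ⟨fun ξ => (2 * Real.pi : ℂ)⁻¹ * Ψ (ξ / (2 * Real.pi)), ?_, ?_, ?_, ?_⟩
  · simpa using hint' 0 (2 * Real.pi : ℂ)⁻¹
  · refine (hint' 1 (-I * (2 * Real.pi : ℂ)⁻¹)).congr (Filter.Eventually.of_forall fun x => ?_)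
    simp only [mulNegI]; ring
  · refine (hint' 2 (-I * -I * (2 * Real.pi : ℂ)⁻¹)).congr (Filter.Eventually.of_forall fun x => ?_)
    simp only [mulNegI]; ring
  · have h1 : 𝓕 Ψ = hc.toSchwartzMap hφ := by rw [hΨ, fourier_fourierInv_eq]
    have h2 : (𝓕 (Ψ : ℝ → ℂ)) = φ := by
      rw [← SchwartzMap.fourier_coe, h1]; rfl
    rw [← h2]
    ext x
    have h3 := Measure.integral_comp_div
      (fun v : ℝ => Complex.exp ((-2 * Real.pi * v * x : ℝ) * I) • Ψ v) (2 * Real.pi)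
    rw [Real.fourier_real_eq_integral_exp_smul, FT]
    rw [abs_of_pos (by positivity)] at h3
    rw [eq_inv_smul_iff₀ hpi |>.2 h3.symm, ← integral_smul]
    congr 1; ext ξ
    have : (Real.pi : ℂ) ≠ 0 := by exact_mod_cast Real.pi_ne_zero
    simp only [smul_eq_mul, real_smul]
    rw [show (((-2 * Real.pi * (ξ / (2 * Real.pi)) * x : ℝ) : ℂ)) * I = -(I * ξ * x) by
      push_cast; field_simp]
    push_cast
    ring

theorem FT_FT_neg {F : ℝ → ℂ} (hF : Continuous F) (hFi : Integrable F) (hFT : Integrable (FT F))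
    (ξ : ℝ) : FT (fun x => FT F (-x)) ξ = 2 * Real.pi * F ξ := by
  have hpi : 2 * Real.pi ≠ 0 := by positivity
  have hfou : Integrable (𝓕 F) := by
    have := hFT.comp_mul_left' hpi
    refine this.congr (Filter.Eventually.of_forall fun x => ?_)
    simp only [FT_eq_fourier]
    rw [mul_div_cancel_left₀ _ hpi]
  have h := congrFun (hF.fourier_fourierInv_eq hFi hfou) ξ
  rw [← h, Real.fourier_real_eq_integral_exp_smul]
  have h3 := Measure.integral_comp_div
    (fun v : ℝ => Complex.exp ((-2 * Real.pi * v * ξ : ℝ) * I) • 𝓕⁻ F v) (2 * Real.pi)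
  rw [abs_of_pos (by positivity), real_smul] at h3
  push_cast at h3
  push_cast
  rw [← h3, FT]
  congr 1; ext x
  have : (Real.pi : ℂ) ≠ 0 := by exact_mod_cast Real.pi_ne_zero
  rw [FT_eq_fourier, Real.fourierInv_eq_fourier_neg, smul_eq_mul, mul_comm, neg_div]
  congr 2
  field_simp

theorem enorm_sq_eLpNorm (F : ℝ → ℂ) : eLpNorm F 2 volume ^ 2 = ∫⁻ x : ℝ, ‖F x‖ₑ ^ 2 := by
  rw [eLpNorm_eq_lintegral_rpow_enorm_toReal (by simp) (by simp)]
  simp only [ENNReal.toReal_ofNat, ENNReal.rpow_ofNat]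
  rw [← ENNReal.rpow_natCast, ← ENNReal.rpow_mul]
  norm_num

theorem eLpNorm_fourier {F : ℝ → ℂ} (hF : Integrable F) (hF2 : MemLp F 2) :
    eLpNorm (𝓕 F) 2 volume = eLpNorm F 2 volume := by
  set f : Lp ℂ 2 (volume : Measure ℝ) := hF2.toLp F with hf
  have hcont : Continuous (𝓕 F) := by
    have h := (continuous_FT hF).comp (continuous_const_mul (2 * Real.pi))
    refine h.congr fun x => ?_
    simp only [Function.comp, FT_eq_fourier]
    rw [mul_div_cancel_left₀ _ (by positivity)]
  have hae : 𝓕 F =ᵐ[volume] (𝓕 f : Lp ℂ 2 (volume : Measure ℝ)) := by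
    refine ae_eq_of_integral_contDiff_smul_eq hcont.locallyIntegrable
      ((Lp.memLp _).locallyIntegrable (by norm_num)) fun g g_smooth g_cpt => ?_
    have hg₁ : HasCompactSupport (Complex.ofRealCLM ∘ g) := g_cpt.comp_left rfl
    have hg₂ : ContDiff ℝ ∞ (Complex.ofRealCLM ∘ g) := by fun_prop
    set G : 𝓢(ℝ, ℂ) := hg₁.toSchwartzMap hg₂
    have h1 := congrArg (fun T => T G) (Lp.fourier_toTemperedDistribution_eq f)
    simp only [TemperedDistribution.fourier_apply, Lp.toTemperedDistribution_apply] at h1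
    have h2 : ∫ x : ℝ, (𝓕 G) x • (f : ℝ → ℂ) x = ∫ x : ℝ, F x • 𝓕 (G : ℝ → ℂ) x := by
      refine integral_congr_ae ?_
      filter_upwards [hF2.coeFn_toLp] with x hx
      rw [hf, hx, SchwartzMap.fourier_coe, smul_eq_mul, smul_eq_mul, mul_comm]
    have h3 := VectorFourier.integral_fourierIntegral_smul_eq_flip (L := innerₗ ℝ)
      (μ := volume) (ν := volume) Real.continuous_fourierChar continuous_inner hF G.integrable
    have h4 : ∫ x : ℝ, (𝓕 F) x • G x = ∫ x : ℝ, F x • 𝓕 (G : ℝ → ℂ) x := by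
      simpa using! h3
    calc ∫ x, g x • 𝓕 F x = ∫ x : ℝ, (𝓕 F) x • G x := by
          congr 1; ext x
          simp [G, mul_comm]
      _ = ∫ x : ℝ, G x • ((𝓕 f : Lp ℂ 2 (volume : Measure ℝ)) : ℝ → ℂ) x := by
          rw [h4, ← h2, h1]
      _ = _ := by
          congr 1
  rw [eLpNorm_congr_ae hae, ← eLpNorm_congr_ae hF2.coeFn_toLp, ← hf]
  have h := Lp.norm_fourier_eq f
  rw [Lp.norm_def, Lp.norm_def] at h
  exact (ENNReal.toReal_eq_toReal_iff' (Lp.eLpNorm_ne_top _) (Lp.eLpNorm_ne_top _)).1 h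

theorem lintegral_comp_mul_left (g : ℝ → ℝ≥0∞) {a : ℝ} (ha : 0 < a) :
    ∫⁻ x : ℝ, g (a * x) = ENNReal.ofReal a⁻¹ * ∫⁻ x : ℝ, g x := by
  have hemb := (Homeomorph.mulLeft₀ a ha.ne').measurableEmbedding
  have h := hemb.lintegral_map g (μ := volume)
  have hm : Measure.map (Homeomorph.mulLeft₀ a ha.ne') volume
      = ENNReal.ofReal a⁻¹ • (volume : Measure ℝ) := by
    have := Real.map_volume_mul_left ha.ne'
    rwa [abs_of_pos (inv_pos.2 ha)] at this
  rw [hm, lintegral_smul_measure] at h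
  exact h.symm

/-- Plancherel's identity in the normalization of `FT`. -/
theorem lintegral_FT_sq {F : ℝ → ℂ} (hF : Integrable F) (hF2 : MemLp F 2) :
    ∫⁻ ξ : ℝ, ‖FT F ξ‖ₑ ^ 2 = ENNReal.ofReal (2 * Real.pi) * ∫⁻ x : ℝ, ‖F x‖ₑ ^ 2 := by
  rw [← enorm_sq_eLpNorm F, ← eLpNorm_fourier hF hF2, enorm_sq_eLpNorm]
  have := lintegral_comp_mul_left (fun x => ‖𝓕 F x‖ₑ ^ 2) (a := (2 * Real.pi)⁻¹) (by positivity)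
  rw [inv_inv] at this
  rw [← this]
  simp only [FT_eq_fourier, div_eq_inv_mul]

theorem conv_eq (θ f : ℝ → ℂ) : conv θ f = MeasureTheory.convolution f θ (ContinuousLinearMap.mul ℂ ℂ) volume := by
  ext x
  simp [conv, MeasureTheory.convolution, mul_comm]

theorem integrable_conv {θ f : ℝ → ℂ} (hθ : Integrable θ) (hf : Integrable f) :
    Integrable (conv θ f) := by
  rw [conv_eq]
  exact hf.integrable_convolution _ hθ

theorem FT_conv {θ f : ℝ → ℂ} (hθ : Integrable θ) (hf : Integrable f) (ξ : ℝ) :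
    FT (conv θ f) ξ = FT θ ξ * FT f ξ := by
  rw [conv_eq, FT_eq_fourier, FT_eq_fourier, FT_eq_fourier,
    Real.fourier_mul_convolution_eq hf hθ, mul_comm]

end

section

open scoped ENNReal Topology

theorem mul_le_mul_sq_add {δ : ℝ} (hδ : 0 < δ) (A t : ℝ) :
    A * t ≤ δ * t ^ 2 + A ^ 2 / (4 * δ) := by
  rw [← sub_nonneg]
  have : δ * t ^ 2 + A ^ 2 / (4 * δ) - A * t = (2 * δ * t - A) ^ 2 / (4 * δ) := by
    field_simp; ring
  rw [this]; positivity

/-- A holomorphic function with Gaussian decay in a strip has the same integral along every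
horizontal line. -/
theorem integral_shift {F : ℂ → ℂ} {b C c : ℝ} (hc : 0 < c)
    (hd : ∀ z : ℂ, |z.im| < b → DifferentiableAt ℂ F z)
    (hF : ∀ z : ℂ, |z.im| < b → ‖F z‖ ≤ C * Real.exp (-c * z.re ^ 2))
    {η : ℝ} (hη : |η| < b) :
    ∫ ξ : ℝ, F ξ = ∫ ξ : ℝ, F (ξ + η * I) := by
  have hb : 0 < b := (abs_nonneg η).trans_lt hη
  have hint : ∀ y : ℝ, |y| < b → Integrable (fun ξ : ℝ => F (ξ + y * I)) := fun y hy => by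
    have him : ∀ ξ : ℝ, |((ξ : ℂ) + y * I).im| < b := fun ξ => by simpa using hy
    have hcont : Continuous (fun ξ : ℝ => F (ξ + y * I)) := by
      refine continuous_iff_continuousAt.2 fun ξ => ?_
      exact ContinuousAt.comp (f := fun ξ : ℝ => (ξ : ℂ) + y * I) (hd _ (him ξ)).continuousAt
        (by fun_prop)
    refine ((integrable_exp_neg_mul_sq hc).const_mul C).mono' hcont.aestronglyMeasurable ?_
    refine Filter.Eventually.of_forall fun ξ => ?_
    simpa using hF _ (him ξ)
  have hvert : ∀ ε : ℝ, ε ^ 2 = 1 → Filter.Tendsto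
      (fun T : ℝ => ∫ y in (0:ℝ)..η, F ((ε * T : ℝ) + y * I)) Filter.atTop (𝓝 0) := fun ε hε => by
    have hlim : Filter.Tendsto (fun T : ℝ => C * Real.exp (-c * T ^ 2) * |η - 0|)
        Filter.atTop (𝓝 0) := by
      have h1 : Filter.Tendsto (fun T : ℝ => -c * T ^ 2) Filter.atTop Filter.atBot :=
        (Filter.tendsto_pow_atTop two_ne_zero).const_mul_atTop_of_neg (neg_lt_zero.2 hc)
      have h2 := (Real.tendsto_exp_atBot.comp h1).const_mul C
      simpa using h2.mul_const |η - 0|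
    refine squeeze_zero_norm (fun T => ?_) hlim
    refine intervalIntegral.norm_integral_le_of_norm_le_const fun y hy => ?_
    have hy' : |y| < b := by
      have : |y| ≤ |η| := by
        simpa using Set.abs_sub_left_of_mem_uIcc (Set.uIoc_subset_uIcc hy)
      exact this.trans_lt hη
    refine (hF _ (by simpa using hy')).trans_eq ?_
    simp [mul_pow, hε]
  have hrect : ∀ T : ℝ, (∫ ξ in (-T)..T, F ξ) - (∫ ξ in (-T)..T, F (ξ + η * I))
      + I * (∫ y in (0:ℝ)..η, F ((1 * T : ℝ) + y * I))
      - I * (∫ y in (0:ℝ)..η, F ((-1 * T : ℝ) + y * I)) = 0 := fun T => by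
    have h := Complex.integral_boundary_rect_eq_zero_of_differentiableOn F
      (-T : ℝ) (T + η * I) ?_
    · simpa using h
    · intro z hz
      refine (hd z ?_).differentiableWithinAt
      have him := (mem_reProdIm.1 hz).2
      simp only [ofReal_im, add_im, mul_im, ofReal_re, I_im, mul_one, I_re, mul_zero, add_zero,
        zero_add] at him
      have : |z.im| ≤ |η| := by simpa using Set.abs_sub_left_of_mem_uIcc him
      exact this.trans_lt hη
  have h0 := hint 0 (by simpa using hb)
  simp only [ofReal_zero, zero_mul, add_zero] at h0
  have l1 := intervalIntegral_tendsto_integral h0 Filter.tendsto_neg_atTop_atBot Filter.tendsto_id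
  have l2 := intervalIntegral_tendsto_integral (hint η hη) Filter.tendsto_neg_atTop_atBot
    Filter.tendsto_id
  have l3 := (hvert 1 (by norm_num)).const_mul I
  have l4 := (hvert (-1) (by norm_num)).const_mul I
  have l := ((l1.sub l2).add l3).sub l4
  have l' := tendsto_nhds_unique l (tendsto_const_nhds.congr fun T => (hrect T).symm)
  simpa [sub_eq_zero] using l'

/-- The transform of the part of the solution at scale `s`. -/
noncomputable def mult (θ g : ℝ → ℂ) (s : ℝ) (z : ℂ) : ℂ :=
  cfhat0 θ z / cfhat0 θ (z * s) * LT g (z * s)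

variable {β : ℝ} {θ g : ℝ → ℂ}

theorem norm_cfhat0_div_le {b : ℝ} {z : ℂ} (hz : |z.im| < b) (s : ℝ) :
    ‖cfhat0 θ z / cfhat0 θ (z * s)‖ ≤ Real.exp (b ^ 2 / 2) *
      Real.exp (-((1 - s ^ 2) / 2) * z.re ^ 2 + ‖logFactor θ z - logFactor θ (z * s)‖) := by
  rw [cfhat0, cfhat0, ← Complex.exp_sub, Complex.norm_exp, ← Real.exp_add]
  apply Real.exp_le_exp.2
  have h1 : -z ^ 2 / 2 + logFactor θ z - (-(z * s) ^ 2 / 2 + logFactor θ (z * s))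
      = ((-((1 - s ^ 2) / 2) : ℝ) : ℂ) * z ^ 2 + (logFactor θ z - logFactor θ (z * s)) := by
    push_cast; ring
  have h2 : (z ^ 2).re = z.re ^ 2 - z.im ^ 2 := by rw [pow_two, mul_re]; ring
  rw [h1, add_re, re_ofReal_mul, h2]
  have h3 := Complex.re_le_norm (logFactor θ z - logFactor θ (z * s))
  have h4 : z.im ^ 2 ≤ b ^ 2 := sq_le_sq' (by linarith [(abs_lt.1 hz).1]) (abs_lt.1 hz).2.le
  have h5 : (1 - s ^ 2) / 2 * z.im ^ 2 ≤ 1 / 2 * b ^ 2 := by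
    gcongr; nlinarith [sq_nonneg s]
  nlinarith

theorem norm_le_abs_re_add {b : ℝ} {z : ℂ} (hz : |z.im| < b) : ‖z‖ ≤ |z.re| + b :=
  (Complex.norm_le_abs_re_add_abs_im z).trans (by linarith)

theorem exists_norm_mult_le (hβ : 0 < β) (hθ : ExpInt (β / 2) θ) (h0 : ∫ x : ℝ, θ x = 0)
    (hg : memE β g) {s : ℝ} (hs0 : 0 < s) (hs1 : s < 1) :
    ∃ C c : ℝ, 0 < c ∧ ∀ z : ℂ, |z.im| < β / 2 →
      ‖mult θ g s z‖ ≤ C * Real.exp (-c * z.re ^ 2) := by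
  obtain ⟨A, hA, h⟩ := exists_norm_logFactor_sub_le (half_pos hβ) hθ h0
  have hgs : ExpInt (β / 2 * s) g :=
    expInt_of_memE hg (mul_lt_of_lt_one_right (half_pos hβ) hs1)
  set B := ∫ x : ℝ, ‖g x‖ * Real.exp (β / 2 * s * |x|)
  set δ := (1 - s ^ 2) / 4 with hδ
  have hδ0 : 0 < δ := by rw [hδ]; nlinarith
  refine ⟨Real.exp ((β / 2) ^ 2 / 2) * Real.exp (A ^ 2 / (4 * δ) + A * (β / 2)) * B, δ, hδ0,
    fun z hz => ?_⟩
  have hzs : |(z * s).im| ≤ β / 2 * s := by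
    simp only [mul_im, ofReal_re, ofReal_im, mul_zero, zero_add, abs_mul, abs_of_pos hs0]
    gcongr
  have h1 := norm_cfhat0_div_le (θ := θ) hz s
  have h2 := h z hz s hs0 hs1.le
  have h3 := hgs.norm_LT_le hzs
  have h4 := norm_le_abs_re_add hz
  have h5 := mul_le_mul_sq_add hδ0 A |z.re|
  rw [sq_abs] at h5
  have h6 : -((1 - s ^ 2) / 2) * z.re ^ 2 + ‖logFactor θ z - logFactor θ (z * s)‖
      ≤ (A ^ 2 / (4 * δ) + A * (β / 2)) + -δ * z.re ^ 2 := by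
    have h7 : A * ‖z‖ ≤ A * (|z.re| + β / 2) := by gcongr
    have h8 : (1 - s ^ 2) / 2 = 2 * δ := by rw [hδ]; ring
    rw [h8]
    linarith
  rw [mult, norm_mul]
  calc _ ≤ (Real.exp ((β / 2) ^ 2 / 2) *
        Real.exp ((A ^ 2 / (4 * δ) + A * (β / 2)) + -δ * z.re ^ 2)) * B := by
        gcongr
        exact h1.trans (by gcongr)
    _ = _ := by rw [Real.exp_add]; ring

theorem exists_norm_mult_le_pow (hβ : 0 < β) (hθ : ExpInt (β / 2) θ) (h0 : ∫ x : ℝ, θ x = 0)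
    (hg : memE β g) {k : ℕ} (hmom : ∀ j < k, ∫ x : ℝ, g x * (x : ℂ) ^ j = 0) :
    ∃ C : ℝ, 0 ≤ C ∧ ∀ s : ℝ, 0 < s → s ≤ 1 / 2 → ∀ z : ℂ, |z.im| < β / 2 →
      ‖mult θ g s z‖ ≤ C * s ^ k * Real.exp (-(1 / 4) * z.re ^ 2) := by
  obtain ⟨A, hA, h⟩ := exists_norm_logFactor_sub_le (half_pos hβ) hθ h0
  obtain ⟨B, hB, hgB⟩ := (expInt_of_memE hg (by linarith : β / 4 < β / 2)).norm_LT_le_pow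
    (by positivity) k hmom
  refine ⟨Real.exp ((β / 2) ^ 2 / 2) * Real.exp ((A + 1) ^ 2 / (4 * (1 / 8)) + (A + 1) * (β / 2))
    * (B * k.factorial), by positivity, fun s hs0 hs1 z hz => ?_⟩
  have hzs : |(z * s).im| ≤ β / 4 := by
    simp only [mul_im, ofReal_re, ofReal_im, mul_zero, zero_add, abs_mul, abs_of_pos hs0]
    calc |z.im| * s ≤ β / 2 * (1 / 2) := by gcongr
      _ = β / 4 := by ring
  have h1 := norm_cfhat0_div_le (θ := θ) hz s
  have h2 := h z hz s hs0 (by linarith)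
  have h3 := hgB _ hzs
  have h4 := norm_le_abs_re_add hz
  have h5 := mul_le_mul_sq_add (by norm_num : (0:ℝ) < 1 / 8) (A + 1) |z.re|
  rw [sq_abs] at h5
  have h9 : ‖z‖ ^ k ≤ k.factorial * Real.exp ‖z‖ := by
    have := Real.pow_div_factorial_le_exp ‖z‖ (norm_nonneg z) k
    rwa [div_le_iff₀ (by positivity), mul_comm] at this
  have h10 : ‖LT g (z * s)‖ ≤ B * k.factorial * s ^ k * Real.exp ‖z‖ := by
    refine h3.trans ?_
    rw [norm_mul, norm_real, Real.norm_of_nonneg hs0.le, mul_pow]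
    calc B * (‖z‖ ^ k * s ^ k) ≤ B * ((k.factorial * Real.exp ‖z‖) * s ^ k) := by gcongr
      _ = _ := by ring
  have h6 : -((1 - s ^ 2) / 2) * z.re ^ 2 + ‖logFactor θ z - logFactor θ (z * s)‖ + ‖z‖
      ≤ ((A + 1) ^ 2 / (4 * (1 / 8)) + (A + 1) * (β / 2)) + -(1 / 4) * z.re ^ 2 := by
    have h7 : (A + 1) * ‖z‖ ≤ (A + 1) * (|z.re| + β / 2) := by gcongr
    have h8 : 3 / 8 * z.re ^ 2 ≤ (1 - s ^ 2) / 2 * z.re ^ 2 :=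
      mul_le_mul_of_nonneg_right (by nlinarith) (sq_nonneg _)
    nlinarith
  rw [mult, norm_mul]
  calc _ ≤ (Real.exp ((β / 2) ^ 2 / 2) *
        Real.exp (-((1 - s ^ 2) / 2) * z.re ^ 2 + ‖logFactor θ z - logFactor θ (z * s)‖))
          * (B * k.factorial * s ^ k * Real.exp ‖z‖) := by gcongr
    _ = Real.exp ((β / 2) ^ 2 / 2) * Real.exp (-((1 - s ^ 2) / 2) * z.re ^ 2
          + ‖logFactor θ z - logFactor θ (z * s)‖ + ‖z‖) * (B * k.factorial * s ^ k) := by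
        rw [Real.exp_add _ ‖z‖]; ring
    _ ≤ Real.exp ((β / 2) ^ 2 / 2) * Real.exp (((A + 1) ^ 2 / (4 * (1 / 8)) + (A + 1) * (β / 2))
          + -(1 / 4) * z.re ^ 2) * (B * k.factorial * s ^ k) := by gcongr
    _ = _ := by rw [Real.exp_add _ (-(1 / 4) * z.re ^ 2)]; ring

theorem exists_norm_mult_le_norm_LT (hβ : 0 < β) (hθ : ExpInt (β / 2) θ)
    (h0 : ∫ x : ℝ, θ x = 0) :
    ∃ C : ℝ, 0 ≤ C ∧ ∀ s : ℝ, 1 / 2 ≤ s → s ≤ 1 → ∀ z : ℂ, |z.im| < β / 2 →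
      ‖mult θ g s z‖ ≤ C * ‖LT g (z * s)‖ := by
  obtain ⟨A, hA, h⟩ := exists_norm_logFactor_sub_le_const (half_pos hβ) hθ h0
  refine ⟨Real.exp ((β / 2) ^ 2 / 2) * Real.exp A, by positivity, fun s hs0 hs1 z hz => ?_⟩
  have h1 := norm_cfhat0_div_le (θ := θ) hz s
  have h2 := h z hz s hs0 hs1
  rw [mult, norm_mul]
  gcongr
  refine h1.trans ?_
  gcongr
  have : 0 ≤ (1 - s ^ 2) / 2 * z.re ^ 2 := by
    have : 0 ≤ 1 - s ^ 2 := by nlinarith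
    positivity
  linarith

theorem differentiableAt_mult (hβ : 0 < β) (hθ : ExpInt (β / 2) θ) (h0 : ∫ x : ℝ, θ x = 0)
    (hg : memE β g) {s : ℝ} (hs0 : 0 < s) (hs1 : s < 1) {z : ℂ} (hz : |z.im| < β / 2) :
    DifferentiableAt ℂ (mult θ g s) z := by
  have hzs : |(z * s).im| < β / 2 := (abs_im_mul_le z hs0.le hs1.le).trans_lt hz
  obtain ⟨c, hc1, hc2⟩ := exists_between hzs
  have h1 := (hasDerivAt_cfhat0 (half_pos hβ) hθ h0 hz).differentiableAt
  have h2 := (hasDerivAt_cfhat0 (half_pos hβ) hθ h0 hzs).differentiableAt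
  have h3 := ((expInt_of_memE hg hc2).hasDerivAt_LT hc1).differentiableAt
  have h4 : DifferentiableAt ℂ (fun z : ℂ => z * s) z := by fun_prop
  have h5 : DifferentiableAt ℂ (fun z : ℂ => cfhat0 θ (z * s)) z :=
    DifferentiableAt.comp (g := cfhat0 θ) z h2 h4
  have h6 : DifferentiableAt ℂ (fun z : ℂ => LT g (z * s)) z :=
    DifferentiableAt.comp (g := LT g) z h3 h4
  exact (h1.fun_div h5 (cfhat0_ne_zero _ _)).fun_mul h6

end

section

open scoped ENNReal Topology

variable {β : ℝ} {θ g : ℝ → ℂ}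

theorem exp_le_two_mul_cosh {a b : ℝ} (h : |a| ≤ |b|) : Real.exp a ≤ 2 * Real.cosh b := by
  rw [← Real.cosh_abs b, Real.cosh_eq]
  have h1 : Real.exp a ≤ Real.exp |b| := Real.exp_le_exp.2 ((le_abs_self a).trans h)
  linarith [Real.exp_pos (-|b|)]

theorem norm_mul_exp_sq_le {c : ℝ} (hc : |c| ≤ β / 2) (x : ℝ) :
    ‖g x * (Real.exp (c * x) : ℂ)‖ ^ 2 ≤ 2 * (‖g x‖ ^ 2 * Real.cosh (β * x)) := by
  have hβ : 0 ≤ β := by linarith [abs_nonneg c]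
  rw [norm_mul, norm_real, Real.norm_of_nonneg (Real.exp_nonneg _), mul_pow, ← Real.exp_nat_mul]
  have : Real.exp ((2 : ℕ) * (c * x)) ≤ 2 * Real.cosh (β * x) := by
    refine exp_le_two_mul_cosh ?_
    rw [abs_mul, abs_mul, abs_mul, abs_of_nonneg hβ]
    calc |((2 : ℕ) : ℝ)| * (|c| * |x|) ≤ 2 * (β / 2 * |x|) := by
          rw [Nat.cast_ofNat, abs_two]; gcongr
      _ = β * |x| := by ring
  nlinarith [sq_nonneg ‖g x‖]

theorem aestronglyMeasurable_mul_exp (hg : AEStronglyMeasurable g) (c : ℝ) :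
    AEStronglyMeasurable (fun x : ℝ => g x * (Real.exp (c * x) : ℂ)) :=
  hg.mul (by fun_prop : Continuous fun x : ℝ => (Real.exp (c * x) : ℂ)).aestronglyMeasurable

theorem memLp_mul_exp (hg : memE β g) {c : ℝ} (hc : |c| ≤ β / 2) :
    MemLp (fun x : ℝ => g x * (Real.exp (c * x) : ℂ)) 2 := by
  have hm := aestronglyMeasurable_mul_exp hg.1 c
  refine (memLp_two_iff_integrable_sq_norm hm).2 ((hg.2.const_mul 2).mono' (hm.norm.pow 2) ?_)
  refine Filter.Eventually.of_forall fun x => ?_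
  rw [Real.norm_of_nonneg (by positivity)]
  exact norm_mul_exp_sq_le hc x

theorem lintegral_mul_exp_sq_le (hg : memE β g) {c : ℝ} (hc : |c| ≤ β / 2) :
    ∫⁻ x : ℝ, ‖g x * (Real.exp (c * x) : ℂ)‖ₑ ^ 2
      ≤ ENNReal.ofReal (2 * ∫ x : ℝ, ‖g x‖ ^ 2 * Real.cosh (β * x)) := by
  rw [← integral_const_mul, ofReal_integral_eq_lintegral_ofReal (hg.2.const_mul 2)]
  · refine lintegral_mono fun x => ?_
    rw [← ofReal_norm, ← ENNReal.ofReal_pow (norm_nonneg _)]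
    exact ENNReal.ofReal_le_ofReal (norm_mul_exp_sq_le hc x)
  · exact Filter.Eventually.of_forall fun x => by
      have := Real.cosh_pos (β * x)
      positivity

theorem integrable_mul_exp (hg : memE β g) {c : ℝ} (hc : |c| < β / 2) :
    Integrable (fun x : ℝ => g x * (Real.exp (c * x) : ℂ)) := by
  refine (expInt_of_memE hg hc).2.mono' (aestronglyMeasurable_mul_exp hg.1 c) ?_
  refine Filter.Eventually.of_forall fun x => ?_
  rw [norm_mul, norm_real, Real.norm_of_nonneg (Real.exp_nonneg _)]
  refine mul_le_mul_of_nonneg_left (Real.exp_le_exp.2 ?_) (norm_nonneg _)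
  rw [← abs_mul]
  exact le_abs_self _

theorem LT_eq_FT_mul_exp (g : ℝ → ℂ) (s η ξ : ℝ) :
    LT g ((ξ + η * I) * s) = FT (fun x : ℝ => g x * (Real.exp (s * η * x) : ℂ)) (s * ξ) := by
  unfold LT FT
  congr 1; ext x
  beta_reduce
  rw [mul_assoc (g x), ofReal_exp, ← Complex.exp_add]
  congr 2
  push_cast
  linear_combination -(x * η * s : ℂ) * I_sq

theorem lintegral_LT_sq_le (hg : memE β g) {s η : ℝ} (hs0 : 0 < s) (hs1 : s ≤ 1)
    (hη : |η| < β / 2) :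
    ∫⁻ ξ : ℝ, ‖LT g ((ξ + η * I) * s)‖ₑ ^ 2
      ≤ ENNReal.ofReal (s⁻¹ * (2 * Real.pi * (2 * ∫ x : ℝ, ‖g x‖ ^ 2 * Real.cosh (β * x)))) := by
  have hc : |s * η| < β / 2 := by
    rw [abs_mul, abs_of_pos hs0]
    exact (mul_le_of_le_one_left (abs_nonneg _) hs1).trans_lt hη
  simp only [LT_eq_FT_mul_exp]
  rw [lintegral_comp_mul_left
    (fun ξ => ‖FT (fun x : ℝ => g x * (Real.exp (s * η * x) : ℂ)) ξ‖ₑ ^ 2) hs0,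
    lintegral_FT_sq (integrable_mul_exp hg hc) (memLp_mul_exp hg hc.le),
    ENNReal.ofReal_mul (p := s⁻¹) (by positivity), ENNReal.ofReal_mul (p := 2 * Real.pi) (by positivity)]
  refine mul_le_mul_right (mul_le_mul_right ?_ _) _
  exact lintegral_mul_exp_sq_le hg hc.le

theorem exists_lintegral_mult_sq_le (hβ : 0 < β) (hθ : ExpInt (β / 2) θ)
    (h0 : ∫ x : ℝ, θ x = 0) (hg : memE β g) {k : ℕ}
    (hmom : ∀ j < k, ∫ x : ℝ, g x * (x : ℂ) ^ j = 0) :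
    ∃ C : ℝ, 0 ≤ C ∧ ∀ s : ℝ, 0 < s → s < 1 → ∀ η : ℝ, |η| < β / 2 →
      ∫⁻ ξ : ℝ, ‖mult θ g s (ξ + η * I)‖ₑ ^ 2 ≤ ENNReal.ofReal (C * (s ^ k) ^ 2) := by
  obtain ⟨A, hA, h1⟩ := exists_norm_mult_le_pow hβ hθ h0 hg hmom
  obtain ⟨B, hB, h2⟩ := exists_norm_mult_le_norm_LT (g := g) hβ hθ h0
  set G := ∫ x : ℝ, ‖g x‖ ^ 2 * Real.cosh (β * x)
  have hG : 0 ≤ G := integral_nonneg fun x => by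
    have := Real.cosh_pos (β * x)
    positivity
  set C1 := A ^ 2 * ∫ x : ℝ, Real.exp (-(1 / 2) * x ^ 2)
  set C2 := 2 * B ^ 2 * (2 * Real.pi * (2 * G)) * (2 ^ k) ^ 2
  have hC1 : 0 ≤ C1 := by
    have : 0 ≤ ∫ x : ℝ, Real.exp (-(1 / 2) * x ^ 2) := integral_nonneg fun x => by positivity
    positivity
  have hC2 : 0 ≤ C2 := by positivity
  have him : ∀ ξ η : ℝ, |η| < β / 2 → |((ξ : ℂ) + η * I).im| < β / 2 := fun ξ η h => by simpa using h
  refine ⟨C1 + C2, by positivity, fun s hs0 hs1 η hη => ?_⟩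
  rcases le_total s (1 / 2) with hs | hs
  · have hint : Integrable (fun x : ℝ => (A * s ^ k) ^ 2 * Real.exp (-(1 / 2) * x ^ 2)) :=
      (integrable_exp_neg_mul_sq (by norm_num)).const_mul _
    calc ∫⁻ ξ : ℝ, ‖mult θ g s (ξ + η * I)‖ₑ ^ 2
        ≤ ∫⁻ ξ : ℝ, ENNReal.ofReal ((A * s ^ k) ^ 2 * Real.exp (-(1 / 2) * ξ ^ 2)) := by
          refine lintegral_mono fun ξ => ?_
          rw [← ofReal_norm, ← ENNReal.ofReal_pow (norm_nonneg _)]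
          refine ENNReal.ofReal_le_ofReal ?_
          have h := h1 s hs0 hs _ (him ξ η hη)
          calc _ ≤ (A * s ^ k * Real.exp (-(1 / 4) * ((ξ : ℂ) + η * I).re ^ 2)) ^ 2 := by gcongr
            _ = _ := by
              rw [mul_pow, ← Real.exp_nat_mul]
              congr 2
              simp
              ring
      _ = ENNReal.ofReal (C1 * (s ^ k) ^ 2) := by
          rw [← ofReal_integral_eq_lintegral_ofReal hint
            (Filter.Eventually.of_forall fun x => by positivity), integral_const_mul]
          congr 1; ring
      _ ≤ _ := by gcongr; linarith
  · calc ∫⁻ ξ : ℝ, ‖mult θ g s (ξ + η * I)‖ₑ ^ 2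
        ≤ ∫⁻ ξ : ℝ, ENNReal.ofReal (B ^ 2) * ‖LT g ((ξ + η * I) * s)‖ₑ ^ 2 := by
          refine lintegral_mono fun ξ => ?_
          rw [← ofReal_norm, ← ofReal_norm, ← ENNReal.ofReal_pow (norm_nonneg _),
            ← ENNReal.ofReal_pow (norm_nonneg _), ← ENNReal.ofReal_mul (by positivity), ← mul_pow]
          refine ENNReal.ofReal_le_ofReal ?_
          gcongr
          exact h2 s hs hs1.le _ (him ξ η hη)
      _ ≤ ENNReal.ofReal (B ^ 2) * ENNReal.ofReal (s⁻¹ * (2 * Real.pi * (2 * G))) := by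
          rw [lintegral_const_mul' _ _ ENNReal.ofReal_ne_top]
          gcongr
          exact lintegral_LT_sq_le hg hs0 hs1.le hη
      _ ≤ _ := by
          rw [← ENNReal.ofReal_mul (by positivity)]
          refine ENNReal.ofReal_le_ofReal ?_
          have h3 : s⁻¹ ≤ 2 := by
            rw [inv_le_comm₀ hs0 two_pos]; linarith
          have h4 : 1 ≤ 2 ^ k * s ^ k := by
            rw [← mul_pow]; exact one_le_pow₀ (by linarith)
          calc B ^ 2 * (s⁻¹ * (2 * Real.pi * (2 * G)))
              ≤ B ^ 2 * (2 * (2 * Real.pi * (2 * G))) * 1 := by rw [mul_one]; gcongr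
            _ ≤ B ^ 2 * (2 * (2 * Real.pi * (2 * G))) * (2 ^ k * s ^ k) ^ 2 := by
              gcongr
              exact one_le_pow₀ h4
            _ = C2 * (s ^ k) ^ 2 := by simp only [C2]; ring
            _ ≤ _ := by gcongr; linarith

end

section

open scoped ENNReal Topology

variable {β : ℝ} {θ g : ℝ → ℂ}

/-- The inverse Fourier transform of `mult θ g s`. -/
noncomputable def hfun (θ g : ℝ → ℂ) (s x : ℝ) : ℂ :=
  (2 * Real.pi : ℂ)⁻¹ * FT (fun ξ : ℝ => mult θ g s ξ) (-x)

theorem continuous_mult (hβ : 0 < β) (hθ : ExpInt (β / 2) θ) (h0 : ∫ x : ℝ, θ x = 0)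
    (hg : memE β g) {s : ℝ} (hs0 : 0 < s) (hs1 : s < 1) {η : ℝ} (hη : |η| < β / 2) :
    Continuous (fun ξ : ℝ => mult θ g s (ξ + η * I)) := by
  refine continuous_iff_continuousAt.2 fun ξ => ?_
  exact ContinuousAt.comp (g := mult θ g s) (f := fun ξ : ℝ => (ξ : ℂ) + η * I)
    (differentiableAt_mult hβ hθ h0 hg hs0 hs1 (by simpa using hη)).continuousAt (by fun_prop)

theorem integrable_mult (hβ : 0 < β) (hθ : ExpInt (β / 2) θ) (h0 : ∫ x : ℝ, θ x = 0)
    (hg : memE β g) {s : ℝ} (hs0 : 0 < s) (hs1 : s < 1) {η : ℝ} (hη : |η| < β / 2) :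
    Integrable (fun ξ : ℝ => mult θ g s (ξ + η * I)) := by
  obtain ⟨C, c, hc, h⟩ := exists_norm_mult_le hβ hθ h0 hg hs0 hs1
  refine ((integrable_exp_neg_mul_sq hc).const_mul C).mono'
    (continuous_mult hβ hθ h0 hg hs0 hs1 hη).aestronglyMeasurable
    (Filter.Eventually.of_forall fun ξ => ?_)
  simpa using h (ξ + η * I) (by simpa using hη)

theorem memLp_mult (hβ : 0 < β) (hθ : ExpInt (β / 2) θ) (h0 : ∫ x : ℝ, θ x = 0)
    (hg : memE β g) {s : ℝ} (hs0 : 0 < s) (hs1 : s < 1) {η : ℝ} (hη : |η| < β / 2) :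
    MemLp (fun ξ : ℝ => mult θ g s (ξ + η * I)) 2 := by
  obtain ⟨C, c, hc, h⟩ := exists_norm_mult_le hβ hθ h0 hg hs0 hs1
  have hm := (continuous_mult hβ hθ h0 hg hs0 hs1 hη).aestronglyMeasurable (μ := volume)
  refine (memLp_two_iff_integrable_sq_norm hm).2 (((integrable_exp_neg_mul_sq
    (mul_pos two_pos hc)).const_mul (C ^ 2)).mono' (hm.norm.pow 2)
    (Filter.Eventually.of_forall fun ξ => ?_))
  rw [Real.norm_of_nonneg (by positivity)]
  have h1 : ‖mult θ g s (ξ + η * I)‖ ≤ C * Real.exp (-c * ξ ^ 2) := by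
    simpa using h (ξ + η * I) (by simpa using hη)
  calc _ ≤ (C * Real.exp (-c * ξ ^ 2)) ^ 2 := by gcongr
    _ = _ := by
      rw [mul_pow, ← Real.exp_nat_mul]
      congr 2
      push_cast
      ring

theorem hfun_mul_exp (hβ : 0 < β) (hθ : ExpInt (β / 2) θ) (h0 : ∫ x : ℝ, θ x = 0)
    (hg : memE β g) {s : ℝ} (hs0 : 0 < s) (hs1 : s < 1) {η : ℝ} (hη : |η| < β / 2) (x : ℝ) :
    hfun θ g s x * (Real.exp (η * x) : ℂ)
      = (2 * Real.pi : ℂ)⁻¹ * FT (fun ξ : ℝ => mult θ g s (ξ + η * I)) (-x) := by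
  obtain ⟨C, c, hc, h⟩ := exists_norm_mult_le hβ hθ h0 hg hs0 hs1
  have hshift := integral_shift (F := fun z => mult θ g s z * Complex.exp (-(I * z * (-x : ℝ))))
    (C := C * Real.exp (β / 2 * |x|)) hc (b := β / 2)
    (fun z hz => (differentiableAt_mult hβ hθ h0 hg hs0 hs1 hz).mul (by fun_prop))
    (fun z hz => by
      rw [norm_mul, Complex.norm_exp]
      have h1 : (-(I * z * ((-x : ℝ) : ℂ))).re = -(z.im * x) := by simp
      have h2 : -(z.im * x) ≤ β / 2 * |x| := by
        refine (neg_le_abs _).trans ?_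
        rw [abs_mul]
        gcongr
      rw [h1, mul_right_comm]
      exact mul_le_mul (h z hz) (Real.exp_le_exp.2 h2) (Real.exp_nonneg _)
        ((norm_nonneg _).trans (h z hz))) hη
  rw [hfun, mul_assoc]
  congr 1
  rw [FT, hshift, ← integral_mul_const, FT]
  congr 1; ext ξ
  rw [mul_assoc, ofReal_exp, ← Complex.exp_add]
  congr 2
  push_cast
  linear_combination (x * η : ℂ) * I_sq

theorem lintegral_hfun_mul_exp_sq (hβ : 0 < β) (hθ : ExpInt (β / 2) θ) (h0 : ∫ x : ℝ, θ x = 0)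
    (hg : memE β g) {s : ℝ} (hs0 : 0 < s) (hs1 : s < 1) {η : ℝ} (hη : |η| < β / 2) :
    ∫⁻ x : ℝ, ‖hfun θ g s x * (Real.exp (η * x) : ℂ)‖ₑ ^ 2
      = ENNReal.ofReal ((2 * Real.pi)⁻¹) * ∫⁻ ξ : ℝ, ‖mult θ g s (ξ + η * I)‖ₑ ^ 2 := by
  simp only [hfun_mul_exp hβ hθ h0 hg hs0 hs1 hη, enorm_mul, mul_pow]
  rw [lintegral_const_mul' _ _ (ENNReal.pow_ne_top enorm_ne_top), lintegral_neg_eq_self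
    (fun x => ‖FT (fun ξ : ℝ => mult θ g s (ξ + η * I)) x‖ₑ ^ 2), lintegral_FT_sq
    (integrable_mult hβ hθ h0 hg hs0 hs1 hη) (memLp_mult hβ hθ h0 hg hs0 hs1 hη), ← mul_assoc]
  congr 1
  have : ‖(2 * Real.pi : ℂ)⁻¹‖ₑ = ENNReal.ofReal ((2 * Real.pi)⁻¹) := by
    rw [← ofReal_norm]
    congr 1
    rw [norm_inv, norm_mul, norm_real, Real.norm_of_nonneg Real.pi_pos.le, norm_ofNat]
  rw [this, ← ENNReal.ofReal_pow (by positivity), ← ENNReal.ofReal_mul (by positivity)]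
  congr 1
  field_simp

theorem continuous_hfun (hβ : 0 < β) (hθ : ExpInt (β / 2) θ) (h0 : ∫ x : ℝ, θ x = 0)
    (hg : memE β g) {s : ℝ} (hs0 : 0 < s) (hs1 : s < 1) : Continuous (hfun θ g s) := by
  have h := integrable_mult hβ hθ h0 hg hs0 hs1 (η := 0) (by simpa using hβ)
  simp only [ofReal_zero, zero_mul, add_zero] at h
  exact continuous_const.mul ((continuous_FT h).comp continuous_neg)

theorem exists_lintegral_hfun_sq_le (hβ : 0 < β) (hθ : ExpInt (β / 2) θ)
    (h0 : ∫ x : ℝ, θ x = 0) (hg : memE β g) {k : ℕ}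
    (hmom : ∀ j < k, ∫ x : ℝ, g x * (x : ℂ) ^ j = 0) :
    ∃ C : ℝ, 0 ≤ C ∧ ∀ s : ℝ, 0 < s → s < 1 →
      ∫⁻ x : ℝ, ENNReal.ofReal (‖hfun θ g s x‖ ^ 2 * Real.cosh (β * x))
        ≤ ENNReal.ofReal (C * (s ^ k) ^ 2) := by
  obtain ⟨C, hC, h⟩ := exists_lintegral_mult_sq_le hβ hθ h0 hg hmom
  refine ⟨C, hC, fun s hs0 hs1 => ?_⟩
  have hcont := continuous_hfun hβ hθ h0 hg hs0 hs1
  have hbound : ∀ η : ℝ, |η| < β / 2 → ∫⁻ x : ℝ,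
      ENNReal.ofReal (‖hfun θ g s x‖ ^ 2 * Real.cosh (2 * η * x))
        ≤ ENNReal.ofReal (C * (s ^ k) ^ 2) := fun η hη => by
    have hpt : ∀ x : ℝ, ENNReal.ofReal (‖hfun θ g s x‖ ^ 2 * Real.cosh (2 * η * x))
        = ENNReal.ofReal (1 / 2) * (‖hfun θ g s x * (Real.exp (η * x) : ℂ)‖ₑ ^ 2
          + ‖hfun θ g s x * (Real.exp (-η * x) : ℂ)‖ₑ ^ 2) := fun x => by
      rw [← ofReal_norm, ← ofReal_norm, ← ENNReal.ofReal_pow (norm_nonneg _),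
        ← ENNReal.ofReal_pow (norm_nonneg _), ← ENNReal.ofReal_add (by positivity) (by positivity),
        ← ENNReal.ofReal_mul (by positivity), norm_mul, norm_mul, norm_real, norm_real,
        Real.norm_of_nonneg (Real.exp_nonneg _), Real.norm_of_nonneg (Real.exp_nonneg _),
        mul_pow, mul_pow, ← Real.exp_nat_mul, ← Real.exp_nat_mul, Real.cosh_eq]
      congr 1
      rw [show ((2 : ℕ) : ℝ) * (η * x) = 2 * η * x by push_cast; ring,
        show ((2 : ℕ) : ℝ) * (-η * x) = -(2 * η * x) by push_cast; ring]
      ring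
    have hη' : |-η| < β / 2 := by rwa [abs_neg]
    have hpi : ENNReal.ofReal ((2 * Real.pi)⁻¹) ≤ 1 := by
      rw [ENNReal.ofReal_le_one]
      exact inv_le_one_of_one_le₀ (by linarith [Real.pi_gt_three])
    have hone : ∀ η : ℝ, |η| < β / 2 → ∫⁻ x : ℝ, ‖hfun θ g s x * (Real.exp (η * x) : ℂ)‖ₑ ^ 2
        ≤ ENNReal.ofReal (C * (s ^ k) ^ 2) := fun η hη => by
      rw [lintegral_hfun_mul_exp_sq hβ hθ h0 hg hs0 hs1 hη]
      calc _ ≤ 1 * ENNReal.ofReal (C * (s ^ k) ^ 2) := by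
            gcongr
            exact h s hs0 hs1 η hη
        _ = _ := one_mul _
    simp only [hpt]
    rw [lintegral_const_mul' _ _ ENNReal.ofReal_ne_top, lintegral_add_left]
    · calc _ ≤ ENNReal.ofReal (1 / 2) * (ENNReal.ofReal (C * (s ^ k) ^ 2)
            + ENNReal.ofReal (C * (s ^ k) ^ 2)) := by
            gcongr
            · exact hone η hη
            · exact hone (-η) hη'
        _ = _ := by
          rw [← ENNReal.ofReal_add (by positivity) (by positivity),
            ← ENNReal.ofReal_mul (by positivity)]
          congr 1; ring
    · have : Continuous fun x : ℝ => hfun θ g s x * (Real.exp (η * x) : ℂ) := by fun_prop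
      exact this.enorm.measurable.pow_const 2
  set u : ℕ → ℝ := fun n => β / 2 * (1 - 1 / ((n : ℝ) + 1))
  have hu : Filter.Tendsto u Filter.atTop (𝓝 (β / 2)) := by
    have := (tendsto_one_div_add_atTop_nhds_zero_nat (𝕜 := ℝ)).const_sub 1
    simpa [u] using this.const_mul (β / 2)
  have hu' : ∀ n, |u n| < β / 2 := fun n => by
    have h1 : (0:ℝ) < 1 / ((n : ℝ) + 1) := by positivity
    have h2 : 1 / ((n : ℝ) + 1) ≤ 1 := by
      rw [div_le_one (by positivity)]; linarith [(n.cast_nonneg : (0:ℝ) ≤ n)]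
    rw [abs_of_nonneg (mul_nonneg (by positivity) (by linarith))]
    exact mul_lt_of_lt_one_right (half_pos hβ) (by linarith)
  have hlim : ∀ x : ℝ, Filter.liminf
      (fun n => ENNReal.ofReal (‖hfun θ g s x‖ ^ 2 * Real.cosh (2 * u n * x))) Filter.atTop
        = ENNReal.ofReal (‖hfun θ g s x‖ ^ 2 * Real.cosh (β * x)) := fun x => by
    refine Filter.Tendsto.liminf_eq (ENNReal.tendsto_ofReal ?_)
    have := ((hu.const_mul 2).mul_const x)
    rw [show 2 * (β / 2) * x = β * x by ring] at this
    exact ((Real.continuous_cosh.tendsto _).comp this).const_mul _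
  simp only [← hlim]
  refine (lintegral_liminf_le fun n => ?_).trans ?_
  · exact (by fun_prop : Continuous fun x : ℝ =>
      ‖hfun θ g s x‖ ^ 2 * Real.cosh (2 * u n * x)).measurable.ennreal_ofReal
  · exact Filter.liminf_le_of_frequently_le'
      (Filter.Frequently.of_forall fun n => hbound _ (hu' n))

theorem memE_of_lintegral_lt_top {f : ℝ → ℂ} (hf : AEStronglyMeasurable f)
    (h : ∫⁻ x : ℝ, ENNReal.ofReal (‖f x‖ ^ 2 * Real.cosh (β * x)) < ⊤) : memE β f := by
  refine ⟨hf, ?_⟩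
  have hm : AEStronglyMeasurable (fun x : ℝ => ‖f x‖ ^ 2 * Real.cosh (β * x)) :=
    (hf.norm.pow 2).mul (by fun_prop : Continuous fun x : ℝ =>
      Real.cosh (β * x)).aestronglyMeasurable
  refine (lintegral_ofReal_ne_top_iff_integrable hm (Filter.Eventually.of_forall fun x => ?_)).1 h.ne
  have := Real.cosh_pos (β * x)
  positivity

theorem memE_hfun (hβ : 0 < β) (hθ : ExpInt (β / 2) θ) (h0 : ∫ x : ℝ, θ x = 0)
    (hg : memE β g) {s : ℝ} (hs0 : 0 < s) (hs1 : s < 1) : memE β (hfun θ g s) := by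
  obtain ⟨C, hC, h⟩ := exists_lintegral_hfun_sq_le (k := 0) hβ hθ h0 hg (by simp)
  exact memE_of_lintegral_lt_top (continuous_hfun hβ hθ h0 hg hs0 hs1).aestronglyMeasurable
    ((h s hs0 hs1).trans_lt ENNReal.ofReal_lt_top)

theorem memE.integrable {f : ℝ → ℂ} (hβ : 0 < β) (hf : memE β f) : Integrable f :=
  (expInt_of_memE hf (half_pos hβ)).integrable le_rfl

theorem FT_hfun (hβ : 0 < β) (hθ : ExpInt (β / 2) θ) (h0 : ∫ x : ℝ, θ x = 0)
    (hg : memE β g) {s : ℝ} (hs0 : 0 < s) (hs1 : s < 1) (ξ : ℝ) :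
    FT (hfun θ g s) ξ = mult θ g s ξ := by
  have hb : |(0 : ℝ)| < β / 2 := by simpa using hβ
  have hc := continuous_mult hβ hθ h0 hg hs0 hs1 hb
  have hi := integrable_mult hβ hθ h0 hg hs0 hs1 hb
  simp only [ofReal_zero, zero_mul, add_zero] at hc hi
  have hpi : (2 * Real.pi : ℂ) ≠ 0 := by
    simp [Real.pi_ne_zero]
  have hF : Integrable (FT fun ξ : ℝ => mult θ g s ξ) := by
    have h1 := ((memE.integrable hβ (memE_hfun hβ hθ h0 hg hs0 hs1)).const_mul
      (2 * Real.pi : ℂ)).comp_neg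
    refine h1.congr (Filter.Eventually.of_forall fun x => ?_)
    simp only [hfun, neg_neg]
    rw [mul_inv_cancel_left₀ hpi]
  have h := FT_FT_neg hc hi hF ξ
  have h2 : FT (hfun θ g s) ξ
      = (2 * Real.pi : ℂ)⁻¹ * FT (fun x => FT (fun ξ : ℝ => mult θ g s ξ) (-x)) ξ := by
    rw [FT, FT, ← integral_const_mul]
    simp only [hfun, mul_assoc]
  rw [h2, h, inv_mul_cancel_left₀ hpi]

theorem exists_lintegral_hfun_le (hβ : 0 < β) (hθ : ExpInt (β / 2) θ)
    (h0 : ∫ x : ℝ, θ x = 0) (hg : memE β g) {k : ℕ}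
    (hmom : ∀ j < k, ∫ x : ℝ, g x * (x : ℂ) ^ j = 0) :
    ∃ C : ℝ, 0 ≤ C ∧ ∀ s : ℝ, 0 < s → s < 1 →
      ∫⁻ x : ℝ, ‖hfun θ g s x‖ₑ ≤ ENNReal.ofReal (C * s ^ k) := by
  obtain ⟨C, hC, h⟩ := exists_lintegral_hfun_sq_le hβ hθ h0 hg hmom
  set E := ∫ x : ℝ, Real.exp (-β * |x|)
  have hE : 0 ≤ E := integral_nonneg fun x => (Real.exp_pos _).le
  refine ⟨C + E, by positivity, fun s hs0 hs1 => ?_⟩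
  have hp : 0 < s ^ k := pow_pos hs0 k
  have hint : Integrable fun x : ℝ => s ^ k * Real.exp (-β * |x|) :=
    (integrable_exp_neg_mul_abs hβ).const_mul _
  calc ∫⁻ x : ℝ, ‖hfun θ g s x‖ₑ
      ≤ ∫⁻ x : ℝ, (ENNReal.ofReal (s ^ k)⁻¹ * ENNReal.ofReal (‖hfun θ g s x‖ ^ 2 *
          Real.cosh (β * x)) + ENNReal.ofReal (s ^ k * Real.exp (-β * |x|))) := by
        refine lintegral_mono fun x => ?_
        have hc := Real.cosh_pos (β * x)
        rw [← ofReal_norm, ← ENNReal.ofReal_mul (by positivity),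
          ← ENNReal.ofReal_add (by positivity) (by positivity)]
        refine ENNReal.ofReal_le_ofReal ?_
        have h1 := mul_le_mul_sq_add (div_pos hc hp) 1 ‖hfun θ g s x‖
        have h2 : 1 ≤ 2 * Real.cosh (β * x) * Real.exp (-β * |x|) := by
          have := exp_le_two_mul_cosh (a := β * |x|) (b := β * x) (by rw [abs_mul, abs_mul, abs_abs])
          calc (1 : ℝ) = Real.exp (β * |x|) * Real.exp (-β * |x|) := by
                rw [← Real.exp_add]; simp
            _ ≤ _ := by gcongr
        have h3 : 1 ^ 2 / (4 * (Real.cosh (β * x) / s ^ k)) ≤ s ^ k * Real.exp (-β * |x|) := by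
          rw [show (1:ℝ) ^ 2 / (4 * (Real.cosh (β * x) / s ^ k))
            = s ^ k / (4 * Real.cosh (β * x)) by field_simp, div_le_iff₀ (by positivity)]
          nlinarith
        calc _ ≤ _ := by rw [one_mul] at h1; exact h1
          _ ≤ _ := add_le_add le_rfl h3
          _ = _ := by ring
    _ = ENNReal.ofReal (s ^ k)⁻¹ * (∫⁻ x : ℝ, ENNReal.ofReal (‖hfun θ g s x‖ ^ 2 *
          Real.cosh (β * x))) + ENNReal.ofReal (s ^ k * E) := by
        rw [lintegral_add_right, lintegral_const_mul' _ _ ENNReal.ofReal_ne_top,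
          ← ofReal_integral_eq_lintegral_ofReal hint
            (Filter.Eventually.of_forall fun x => by positivity), integral_const_mul]
        exact (by fun_prop : Continuous fun x : ℝ =>
          s ^ k * Real.exp (-β * |x|)).measurable.ennreal_ofReal
    _ ≤ ENNReal.ofReal (s ^ k)⁻¹ * ENNReal.ofReal (C * (s ^ k) ^ 2) + ENNReal.ofReal (s ^ k * E) := by
        gcongr
        exact h s hs0 hs1
    _ = _ := by
        rw [← ENNReal.ofReal_mul (by positivity), ← ENNReal.ofReal_add (by positivity) (by positivity)]
        congr 1
        field_simp

end

section

open scoped ENNReal Topology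

variable {β : ℝ} {θ g : ℝ → ℂ} {ζ : ℂ} {k : ℕ}

theorem mult_ofReal (θ g : ℝ → ℂ) (s ξ : ℝ) :
    mult θ g s ξ = fhat0 θ ξ / fhat0 θ (s * ξ) * FT g (s * ξ) := by
  rw [mult, ← ofReal_mul, cfhat0_ofReal, cfhat0_ofReal, LT_ofReal, mul_comm ξ s]

theorem continuous_fhat0 (hβ : 0 < β) (hθ : ExpInt (β / 2) θ) (h0 : ∫ x : ℝ, θ x = 0) :
    Continuous (fhat0 θ) := by
  refine continuous_iff_continuousAt.2 fun ξ => ?_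
  have h := (hasDerivAt_cfhat0 (half_pos hβ) hθ h0 (z := (ξ : ℂ))
    (by simpa using hβ)).continuousAt
  have h2 := ContinuousAt.comp (g := cfhat0 θ) (f := fun ξ : ℝ => (ξ : ℂ)) h
    continuous_ofReal.continuousAt
  exact h2.congr (Filter.Eventually.of_forall fun ξ => cfhat0_ofReal θ ξ)

theorem fhat0_ne_zero (θ : ℝ → ℂ) (ξ : ℝ) : fhat0 θ ξ ≠ 0 := Complex.exp_ne_zero _

theorem stronglyMeasurable_hfun (hβ : 0 < β) (hθ : ExpInt (β / 2) θ) (h0 : ∫ x : ℝ, θ x = 0)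
    (hg : memE β g) : StronglyMeasurable (fun p : ℝ × ℝ => hfun θ g p.1 p.2) := by
  have h1 := continuous_fhat0 hβ hθ h0
  have h2 := continuous_FT (memE.integrable hβ hg)
  have hc : Continuous (fun q : (ℝ × ℝ) × ℝ => mult θ g q.1.1 q.2 *
      Complex.exp (-(I * q.2 * ((-q.1.2 : ℝ) : ℂ)))) := by
    simp only [mult_ofReal]
    refine Continuous.mul (Continuous.mul (Continuous.div (by fun_prop) (by fun_prop)
      fun q => fhat0_ne_zero _ _) (by fun_prop)) (by fun_prop)
  exact (hc.stronglyMeasurable.integral_prod_right' (ν := volume)).const_mul _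

theorem measurable_cpow_sub_one (ζ : ℂ) : Measurable (fun s : ℝ => (s : ℂ) ^ (ζ - 1)) := by
  fun_prop

theorem integrableOn_rpow {r : ℝ} (hr : -1 < r) :
    IntegrableOn (fun s : ℝ => s ^ r) (Set.Ioo 0 1) := by
  rw [← integrableOn_Ioc_iff_integrableOn_Ioo, ← intervalIntegrable_iff_integrableOn_Ioc_of_le
    zero_le_one]
  exact intervalIntegral.intervalIntegrable_rpow' hr

theorem lintegral_rpow_lt_top {r : ℝ} (hr : -1 < r) (C : ℝ) :
    ∫⁻ s in Set.Ioo (0:ℝ) 1, ENNReal.ofReal (C * s ^ r) < ⊤ := by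
  have h := ((integrableOn_rpow hr).const_mul C).lintegral_lt_top
  exact h

theorem sq_lintegral_mul_le {α : Type*} [MeasurableSpace α] {μ : Measure α} {u v : α → ℝ≥0∞}
    (hu : AEMeasurable u μ) (hv : AEMeasurable v μ) :
    (∫⁻ a, u a * v a ∂μ) ^ 2 ≤ (∫⁻ a, u a ^ 2 ∂μ) * ∫⁻ a, v a ^ 2 ∂μ := by
  have h := ENNReal.lintegral_mul_le_Lp_mul_Lq μ Real.HolderConjugate.two_two hu hv
  simp only [ENNReal.rpow_two, Pi.mul_apply] at h
  calc _ ≤ ((∫⁻ a, u a ^ 2 ∂μ) ^ (1 / 2 : ℝ) * (∫⁻ a, v a ^ 2 ∂μ) ^ (1 / 2 : ℝ)) ^ 2 := by gcongr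
    _ = _ := by
      rw [mul_pow, ← ENNReal.rpow_natCast, ← ENNReal.rpow_natCast, ← ENNReal.rpow_mul,
        ← ENNReal.rpow_mul]
      norm_num

/-- The solution of the perturbed resolvent equation, as a superposition of its parts at scales
`s ∈ (0, 1)`. -/
noncomputable def fsol (θ g : ℝ → ℂ) (ζ : ℂ) (x : ℝ) : ℂ :=
  ∫ s in Set.Ioo (0:ℝ) 1, (s : ℂ) ^ (ζ - 1) * hfun θ g s x

theorem enorm_cpow_sub_one {s : ℝ} (hs : 0 < s) (ζ : ℂ) :
    ‖(s : ℂ) ^ (ζ - 1)‖ₑ = ENNReal.ofReal (s ^ (ζ.re - 1)) := by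
  rw [← ofReal_norm, norm_cpow_eq_rpow_re_of_pos hs, sub_re, one_re]

theorem integrable_cpow_mul_hfun (hβ : 0 < β) (hθ : ExpInt (β / 2) θ) (h0 : ∫ x : ℝ, θ x = 0)
    (hg : memE β g) (hmom : ∀ j < k, ∫ x : ℝ, g x * (x : ℂ) ^ j = 0) (hζ : -(k : ℝ) < ζ.re) :
    Integrable (fun p : ℝ × ℝ => (p.1 : ℂ) ^ (ζ - 1) * hfun θ g p.1 p.2)
      ((volume.restrict (Set.Ioo 0 1)).prod volume) := by
  obtain ⟨C, hC, h⟩ := exists_lintegral_hfun_le hβ hθ h0 hg hmom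
  have hm : Measurable (fun p : ℝ × ℝ => (p.1 : ℂ) ^ (ζ - 1) * hfun θ g p.1 p.2) :=
    ((measurable_cpow_sub_one ζ).comp measurable_fst).mul
      (stronglyMeasurable_hfun hβ hθ h0 hg).measurable
  refine ⟨hm.aestronglyMeasurable, ?_⟩
  rw [hasFiniteIntegral_iff_enorm, lintegral_prod _ hm.enorm.aemeasurable]
  refine lt_of_le_of_lt (setLIntegral_mono' measurableSet_Ioo fun s hs => ?_)
    (lintegral_rpow_lt_top (r := ζ.re - 1 + k) (by linarith) C)
  simp only [enorm_mul]
  rw [lintegral_const_mul' _ _ enorm_ne_top, enorm_cpow_sub_one hs.1]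
  calc _ ≤ ENNReal.ofReal (s ^ (ζ.re - 1)) * ENNReal.ofReal (C * s ^ k) := by
        gcongr
        exact h s hs.1 hs.2
    _ = _ := by
      rw [← ENNReal.ofReal_mul (Real.rpow_nonneg hs.1.le _), Real.rpow_add hs.1, Real.rpow_natCast]
      congr 1; ring

theorem FT_fsol (hβ : 0 < β) (hθ : ExpInt (β / 2) θ) (h0 : ∫ x : ℝ, θ x = 0)
    (hg : memE β g) (hmom : ∀ j < k, ∫ x : ℝ, g x * (x : ℂ) ^ j = 0) (hζ : -(k : ℝ) < ζ.re)
    (ξ : ℝ) : FT (fsol θ g ζ) ξ = fhat0 θ ξ *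
      ∫ s in (0:ℝ)..1, (FT g (s * ξ) / fhat0 θ (s * ξ)) * (s : ℂ) ^ (ζ - 1) := by
  have hint := integrable_cpow_mul_hfun hβ hθ h0 hg hmom hζ
  have hswap : Integrable (Function.uncurry fun x s : ℝ => (s : ℂ) ^ (ζ - 1) * hfun θ g s x *
      Complex.exp (-(I * x * ξ))) (volume.prod (volume.restrict (Set.Ioo 0 1))) := by
    have h1 := hint.swap
    refine (h1.bdd_mul (c := 1) (f := fun p : ℝ × ℝ => Complex.exp (-(I * p.1 * ξ)))
      (by fun_prop : Continuous fun p : ℝ × ℝ =>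
        Complex.exp (-(I * p.1 * ξ))).aestronglyMeasurable ?_).congr ?_
    · exact Filter.Eventually.of_forall fun p => (norm_kernel_real p.1 ξ).le
    · exact Filter.Eventually.of_forall fun p => mul_comm _ _
  calc FT (fsol θ g ζ) ξ = ∫ x : ℝ, ∫ s in Set.Ioo (0:ℝ) 1,
        (s : ℂ) ^ (ζ - 1) * hfun θ g s x * Complex.exp (-(I * x * ξ)) := by
        simp only [FT, fsol, integral_mul_const]
    _ = ∫ s in Set.Ioo (0:ℝ) 1, (s : ℂ) ^ (ζ - 1) * FT (hfun θ g s) ξ := by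
        rw [integral_integral_swap hswap]
        simp only [FT, mul_assoc, integral_const_mul]
    _ = ∫ s in Set.Ioo (0:ℝ) 1,
        fhat0 θ ξ * ((FT g (s * ξ) / fhat0 θ (s * ξ)) * (s : ℂ) ^ (ζ - 1)) := by
        refine setIntegral_congr_fun measurableSet_Ioo fun s hs => ?_
        rw [FT_hfun hβ hθ h0 hg hs.1 hs.2, mult_ofReal]
        ring
    _ = _ := by
        rw [integral_const_mul, intervalIntegral.integral_of_le zero_le_one,
          integral_Ioc_eq_integral_Ioo]

theorem memE_fsol (hβ : 0 < β) (hθ : ExpInt (β / 2) θ) (h0 : ∫ x : ℝ, θ x = 0)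
    (hg : memE β g) (hmom : ∀ j < k, ∫ x : ℝ, g x * (x : ℂ) ^ j = 0) (hζ : -(k : ℝ) < ζ.re) :
    memE β (fsol θ g ζ) := by
  obtain ⟨C, hC, h⟩ := exists_lintegral_hfun_sq_le hβ hθ h0 hg hmom
  have hh := (stronglyMeasurable_hfun hβ hθ h0 hg).measurable
  have hm : Measurable (fun p : ℝ × ℝ => (p.1 : ℂ) ^ (ζ - 1) * hfun θ g p.1 p.2) :=
    ((measurable_cpow_sub_one ζ).comp measurable_fst).mul hh
  have hf : StronglyMeasurable (fsol θ g ζ) :=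
    (hm.comp measurable_swap).stronglyMeasurable.integral_prod_right'
  refine memE_of_lintegral_lt_top hf.aestronglyMeasurable ?_
  set ν : Measure ℝ := volume.restrict (Set.Ioo 0 1)
  set a := ζ.re - 1
  set K := ∫⁻ s in Set.Ioo (0:ℝ) 1, ENNReal.ofReal (1 * s ^ (a + k))
  have hK : K < ⊤ := lintegral_rpow_lt_top (by simp only [a]; linarith) 1
  have hpt : ∀ x : ℝ, ‖fsol θ g ζ x‖ₑ ^ 2
      ≤ K * ∫⁻ s, ENNReal.ofReal (s ^ (a - k)) * ‖hfun θ g s x‖ₑ ^ 2 ∂ν := fun x => by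
    have hx : Measurable fun s : ℝ => hfun θ g s x :=
      Measurable.comp (g := fun p : ℝ × ℝ => hfun θ g p.1 p.2) (f := fun s : ℝ => (s, x)) hh
        measurable_prodMk_right
    calc ‖fsol θ g ζ x‖ₑ ^ 2 ≤ (∫⁻ s, ‖(s : ℂ) ^ (ζ - 1) * hfun θ g s x‖ₑ ∂ν) ^ 2 := by
          gcongr
          exact enorm_integral_le_lintegral_enorm _
      _ = (∫⁻ s, ENNReal.ofReal (s ^ ((a + k) / 2)) *
            (ENNReal.ofReal (s ^ ((a - k) / 2)) * ‖hfun θ g s x‖ₑ) ∂ν) ^ 2 := by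
          congr 1
          refine setLIntegral_congr_fun measurableSet_Ioo fun s hs => ?_
          rw [enorm_mul, enorm_cpow_sub_one hs.1, ← mul_assoc,
            ← ENNReal.ofReal_mul (Real.rpow_nonneg hs.1.le _), ← Real.rpow_add hs.1]
          congr 3; ring
      _ ≤ _ := sq_lintegral_mul_le (by fun_prop) (by fun_prop)
      _ = _ := by
          congr 1
          · refine setLIntegral_congr_fun measurableSet_Ioo fun s hs => ?_
            rw [← ENNReal.ofReal_pow (Real.rpow_nonneg hs.1.le _), ← Real.rpow_mul_natCast hs.1.le,
              one_mul]
            congr 2; push_cast; ring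
          · refine setLIntegral_congr_fun measurableSet_Ioo fun s hs => ?_
            rw [mul_pow, ← ENNReal.ofReal_pow (Real.rpow_nonneg hs.1.le _),
              ← Real.rpow_mul_natCast hs.1.le]
            congr 3; push_cast; ring
  have hsplit : ∀ (f : ℝ → ℂ) (x : ℝ), ENNReal.ofReal (‖f x‖ ^ 2 * Real.cosh (β * x))
      = ‖f x‖ₑ ^ 2 * ENNReal.ofReal (Real.cosh (β * x)) := fun f x => by
    rw [ENNReal.ofReal_mul (by positivity), ENNReal.ofReal_pow (norm_nonneg _), ofReal_norm]
  calc ∫⁻ x : ℝ, ENNReal.ofReal (‖fsol θ g ζ x‖ ^ 2 * Real.cosh (β * x))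
      ≤ ∫⁻ x : ℝ, K * ∫⁻ s, ENNReal.ofReal (s ^ (a - k)) *
          ENNReal.ofReal (‖hfun θ g s x‖ ^ 2 * Real.cosh (β * x)) ∂ν := by
        refine lintegral_mono fun x => ?_
        simp only [hsplit, ← mul_assoc]
        rw [lintegral_mul_const' _ _ ENNReal.ofReal_ne_top, ← mul_assoc]
        gcongr
        exact hpt x
    _ = K * ∫⁻ s, ENNReal.ofReal (s ^ (a - k)) *
          (∫⁻ x : ℝ, ENNReal.ofReal (‖hfun θ g s x‖ ^ 2 * Real.cosh (β * x))) ∂ν := by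
        rw [lintegral_const_mul' _ _ hK.ne, lintegral_lintegral_swap]
        · simp only [lintegral_const_mul' _ _ ENNReal.ofReal_ne_top]
        · refine Measurable.aemeasurable ?_
          have : Measurable fun p : ℝ × ℝ => hfun θ g p.2 p.1 :=
            Measurable.comp (g := fun p : ℝ × ℝ => hfun θ g p.1 p.2)
              (f := fun p : ℝ × ℝ => (p.2, p.1)) hh (measurable_snd.prodMk measurable_fst)
          simp only [Function.uncurry_def]
          have h2 : Measurable fun p : ℝ × ℝ => Real.cosh (β * p.1) := by fun_prop
          fun_prop
    _ ≤ K * ∫⁻ s, ENNReal.ofReal (C * s ^ (a + k)) ∂ν := by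
        refine mul_le_mul_right (setLIntegral_mono' measurableSet_Ioo fun s hs => ?_) _
        calc _ ≤ ENNReal.ofReal (s ^ (a - k)) * ENNReal.ofReal (C * (s ^ k) ^ 2) := by
              gcongr
              exact h s hs.1 hs.2
          _ = _ := by
            rw [← ENNReal.ofReal_mul (Real.rpow_nonneg hs.1.le _), Real.rpow_sub hs.1,
              Real.rpow_add hs.1, Real.rpow_natCast]
            congr 1
            have := (pow_pos hs.1 k).ne'
            field_simp
    _ < ⊤ := ENNReal.mul_lt_top hK (lintegral_rpow_lt_top (by simp only [a]; linarith) C)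

end

section

open scoped ENNReal Topology

variable {β : ℝ} {θ g : ℝ → ℂ} {ζ : ℂ} {k : ℕ}

theorem exists_hasDerivAt_fhat0 (hβ : 0 < β) (hθ : ExpInt (β / 2) θ) (h0 : ∫ x : ℝ, θ x = 0)
    (ξ : ℝ) : ∃ d : ℂ, HasDerivAt (fhat0 θ) d ξ ∧
      ξ * d = fhat0 θ ξ * (-(ξ : ℂ) ^ 2 + FT θ ξ) := by
  have hz : |((ξ : ℝ) : ℂ).im| < β / 2 := by simpa using hβ
  have h := (hasDerivAt_cfhat0 (half_pos hβ) hθ h0 hz).comp_ofReal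
  refine ⟨_, h.congr_of_eventuallyEq
    (Filter.Eventually.of_forall fun x => (cfhat0_ofReal θ x).symm), ?_⟩
  have h2 := mul_integral_LT_mulNegI hθ h0 hz
  rw [LT_ofReal] at h2
  rw [← h2, cfhat0_ofReal]
  ring

theorem memE.integrable_mulNegI {f : ℝ → ℂ} (hβ : 0 < β) (hf : memE β f) :
    Integrable (mulNegI f) :=
  ((expInt_of_memE hf (by linarith : β / 4 < β / 2)).mulNegI
    (by positivity : (0 : ℝ) < β / 4)).integrable le_rfl

theorem exists_norm_FT_le_pow {f : ℝ → ℂ} (hβ : 0 < β) (hf : memE β f)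
    (hmom : ∀ j < k, ∫ x : ℝ, f x * (x : ℂ) ^ j = 0) :
    ∃ C : ℝ, 0 ≤ C ∧ ∀ ξ : ℝ, ‖FT f ξ‖ ≤ C * |ξ| ^ k := by
  obtain ⟨C, hC, h⟩ := (expInt_of_memE hf (by linarith : β / 4 < β / 2)).norm_LT_le_pow
    (by positivity) k hmom
  refine ⟨C, hC, fun ξ => ?_⟩
  simpa [LT_ofReal] using h ξ (by simp; positivity)

theorem exists_norm_inv_fhat0_le (hβ : 0 < β) (hθ : ExpInt (β / 2) θ) (h0 : ∫ x : ℝ, θ x = 0)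
    (R : ℝ) : ∃ C : ℝ, 0 ≤ C ∧ ∀ ξ : ℝ, |ξ| ≤ R → ‖(fhat0 θ ξ)⁻¹‖ ≤ C := by
  have hc : Continuous fun ξ => (fhat0 θ ξ)⁻¹ :=
    (continuous_fhat0 hβ hθ h0).inv₀ (fhat0_ne_zero θ)
  obtain ⟨C, hC⟩ := (isCompact_Icc (a := -R) (b := R)).exists_bound_of_continuousOn hc.continuousOn
  refine ⟨max C 0, le_max_right _ _, fun ξ hξ => (hC ξ (abs_le.1 hξ)).trans (le_max_left _ _)⟩

theorem exists_norm_FT_div_fhat0_le (hβ : 0 < β) (hθ : ExpInt (β / 2) θ)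
    (h0 : ∫ x : ℝ, θ x = 0) {f : ℝ → ℂ} (hf : memE β f)
    (hmom : ∀ j < k, ∫ x : ℝ, f x * (x : ℂ) ^ j = 0) (R : ℝ) :
    ∃ C : ℝ, 0 ≤ C ∧ ∀ ξ : ℝ, |ξ| ≤ R → ‖FT f ξ / fhat0 θ ξ‖ ≤ C * |ξ| ^ k := by
  obtain ⟨A, hA, h1⟩ := exists_norm_FT_le_pow hβ hf hmom
  obtain ⟨B, hB, h2⟩ := exists_norm_inv_fhat0_le hβ hθ h0 R
  refine ⟨A * B, by positivity, fun ξ hξ => ?_⟩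
  rw [div_eq_mul_inv, norm_mul]
  calc _ ≤ A * |ξ| ^ k * B := by gcongr; exacts [h1 ξ, h2 ξ hξ]
    _ = _ := by ring

theorem continuous_FT_div_fhat0 (hβ : 0 < β) (hθ : ExpInt (β / 2) θ) (h0 : ∫ x : ℝ, θ x = 0)
    {f : ℝ → ℂ} (hf : memE β f) : Continuous fun ξ => FT f ξ / fhat0 θ ξ :=
  (continuous_FT (memE.integrable hβ hf)).div (continuous_fhat0 hβ hθ h0) (fhat0_ne_zero θ)

/-- The integral in the formula for the transform of the solution. -/
noncomputable def radial (θ g : ℝ → ℂ) (ζ : ℂ) (ξ : ℝ) : ℂ :=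
  ∫ s in (0:ℝ)..1, (FT g (s * ξ) / fhat0 θ (s * ξ)) * (s : ℂ) ^ (ζ - 1)

theorem exists_norm_radial_integrand_le (hβ : 0 < β) (hθ : ExpInt (β / 2) θ)
    (h0 : ∫ x : ℝ, θ x = 0) (hg : memE β g)
    (hmom : ∀ j < k, ∫ x : ℝ, g x * (x : ℂ) ^ j = 0) (ζ : ℂ) (R : ℝ) :
    ∃ C : ℝ, 0 ≤ C ∧ ∀ ξ : ℝ, |ξ| ≤ R → ∀ s : ℝ, s ∈ Set.Ioc (0:ℝ) 1 →
      ‖(FT g (s * ξ) / fhat0 θ (s * ξ)) * (s : ℂ) ^ (ζ - 1)‖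
        ≤ C * |ξ| ^ k * s ^ (ζ.re - 1 + k) := by
  obtain ⟨C, hC, h⟩ := exists_norm_FT_div_fhat0_le hβ hθ h0 hg hmom R
  refine ⟨C, hC, fun ξ hξ s hs => ?_⟩
  have habs : |s * ξ| = s * |ξ| := by rw [abs_mul, abs_of_pos hs.1]
  have h1 := h (s * ξ) (by
    rw [habs]; exact (mul_le_of_le_one_left (abs_nonneg _) hs.2).trans hξ)
  rw [habs, mul_pow] at h1
  rw [norm_mul, norm_cpow_eq_rpow_re_of_pos hs.1, sub_re, one_re, Real.rpow_add hs.1,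
    Real.rpow_natCast]
  have h2 := Real.rpow_nonneg hs.1.le (ζ.re - 1)
  calc _ ≤ C * (s ^ k * |ξ| ^ k) * s ^ (ζ.re - 1) := by gcongr
    _ = _ := by ring

theorem intervalIntegrable_rpow_sub_one_add (hζ : -(k : ℝ) < ζ.re) :
    IntervalIntegrable (fun s : ℝ => s ^ (ζ.re - 1 + k)) volume 0 1 :=
  intervalIntegral.intervalIntegrable_rpow' (by linarith)

theorem measurable_radial_integrand (hβ : 0 < β) (hθ : ExpInt (β / 2) θ)
    (h0 : ∫ x : ℝ, θ x = 0) (hg : memE β g) (ζ : ℂ) (ξ : ℝ) :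
    Measurable fun s : ℝ => (FT g (s * ξ) / fhat0 θ (s * ξ)) * (s : ℂ) ^ (ζ - 1) :=
  ((continuous_FT_div_fhat0 hβ hθ h0 hg).comp (continuous_mul_const ξ)).measurable.mul
    (measurable_cpow_sub_one ζ)

theorem intervalIntegrable_radial (hβ : 0 < β) (hθ : ExpInt (β / 2) θ)
    (h0 : ∫ x : ℝ, θ x = 0) (hg : memE β g)
    (hmom : ∀ j < k, ∫ x : ℝ, g x * (x : ℂ) ^ j = 0) (hζ : -(k : ℝ) < ζ.re) (ξ : ℝ) :
    IntervalIntegrable (fun s : ℝ => (FT g (s * ξ) / fhat0 θ (s * ξ)) * (s : ℂ) ^ (ζ - 1))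
      volume 0 1 := by
  obtain ⟨C, hC, h⟩ := exists_norm_radial_integrand_le hβ hθ h0 hg hmom ζ |ξ|
  refine ((intervalIntegrable_rpow_sub_one_add hζ).const_mul (C * |ξ| ^ k)).mono_fun'
    (measurable_radial_integrand hβ hθ h0 hg ζ ξ).aestronglyMeasurable ?_
  rw [Set.uIoc_of_le zero_le_one]
  exact (ae_restrict_iff' measurableSet_Ioc).2
    (Filter.Eventually.of_forall fun s hs => h ξ le_rfl s hs)

theorem moments_fsol_eq_zero (hβ : 0 < β) (hθ : ExpInt (β / 2) θ) (h0 : ∫ x : ℝ, θ x = 0)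
    (hg : memE β g) (hmom : ∀ j < k, ∫ x : ℝ, g x * (x : ℂ) ^ j = 0) (hζ : -(k : ℝ) < ζ.re) :
    ∀ j < k, ∫ x : ℝ, fsol θ g ζ x * (x : ℂ) ^ j = 0 := by
  obtain ⟨C, hC, h⟩ := exists_norm_radial_integrand_le hβ hθ h0 hg hmom ζ 1
  obtain ⟨M, hM⟩ := (isCompact_Icc (a := (0:ℝ)) (b := 1)).exists_bound_of_continuousOn
    (continuous_fhat0 hβ hθ h0).continuousOn
  have hM0 : 0 ≤ M := (norm_nonneg _).trans (hM 0 (by simp))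
  refine (expInt_of_memE (memE_fsol hβ hθ h0 hg hmom hζ)
    (by linarith : β / 4 < β / 2)).moments_eq_zero (by positivity)
    (C := M * (C * ∫ s in (0:ℝ)..1, s ^ (ζ.re - 1 + k))) fun ξ hξ0 hξ1 => ?_
  have habs : |ξ| = ξ := abs_of_pos hξ0
  rw [FT_fsol hβ hθ h0 hg hmom hζ, norm_mul]
  have h1 := intervalIntegral.norm_integral_le_of_norm_le zero_le_one
    (Filter.Eventually.of_forall fun s hs => h ξ (habs.trans_le hξ1) s hs)
    ((intervalIntegrable_rpow_sub_one_add hζ).const_mul (C * |ξ| ^ k))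
  rw [intervalIntegral.integral_const_mul, habs] at h1
  calc _ ≤ M * (C * ξ ^ k * ∫ s in (0:ℝ)..1, s ^ (ζ.re - 1 + k)) := by
        gcongr
        exact hM ξ ⟨hξ0.le, hξ1⟩
    _ = _ := by ring

theorem cpow_mul_radial (θ g : ℝ → ℂ) (ζ : ℂ) (ξ : ℝ) {t : ℝ} (ht : 0 < t) :
    (t : ℂ) ^ ζ * radial θ g ζ (t * ξ)
      = ∫ u in (0:ℝ)..t, (FT g (u * ξ) / fhat0 θ (u * ξ)) * (u : ℂ) ^ (ζ - 1) := by
  have h := intervalIntegral.integral_comp_mul_left (a := 0) (b := 1)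
    (fun u : ℝ => (FT g (u * ξ) / fhat0 θ (u * ξ)) * (u : ℂ) ^ (ζ - 1)) ht.ne'
  rw [mul_zero, mul_one, eq_inv_smul_iff₀ ht.ne'] at h
  have ht' : (t : ℂ) ≠ 0 := ofReal_ne_zero.2 ht.ne'
  rw [← h, radial, real_smul, ← intervalIntegral.integral_const_mul,
    ← intervalIntegral.integral_const_mul]
  refine intervalIntegral.integral_congr fun s hs => ?_
  rw [Set.uIcc_of_le zero_le_one] at hs
  rw [ofReal_mul, mul_cpow_ofReal_nonneg ht.le hs.1, show s * (t * ξ) = t * s * ξ by ring,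
    cpow_sub _ _ ht', cpow_one]
  field_simp

theorem radial_ode (hβ : 0 < β) (hθ : ExpInt (β / 2) θ) (h0 : ∫ x : ℝ, θ x = 0)
    (hg : memE β g) (hmom : ∀ j < k, ∫ x : ℝ, g x * (x : ℂ) ^ j = 0) (hζ : -(k : ℝ) < ζ.re)
    {ξ : ℝ} {d : ℂ} (hd : HasDerivAt (radial θ g ζ) d ξ) :
    ζ * radial θ g ζ ξ + ξ * d = FT g ξ / fhat0 θ ξ := by
  have h1 : HasDerivAt (fun t : ℝ => (t : ℂ) ^ ζ * radial θ g ζ (t * ξ))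
      (ζ * radial θ g ζ ξ + ξ * d) 1 := by
    have e1 : HasDerivAt (fun t : ℝ => (t : ℂ) ^ ζ) ζ 1 := by
      have := ((hasDerivAt_id (1 : ℂ)).cpow_const (c := ζ) (by simp)).comp_ofReal (z := 1)
      simpa using this
    have e2 : HasDerivAt (fun t : ℝ => radial θ g ζ (t * ξ)) (ξ • d) 1 := by
      have hd' : HasDerivAt (radial θ g ζ) d (1 * ξ) := by rwa [one_mul]
      have := hd'.scomp (1 : ℝ) ((hasDerivAt_id (1 : ℝ)).mul_const ξ)
      simpa [Function.comp_def] using this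
    refine (e1.fun_mul e2).congr_deriv ?_
    simp
  have h2 : HasDerivAt (fun t : ℝ =>
      ∫ u in (0:ℝ)..t, (FT g (u * ξ) / fhat0 θ (u * ξ)) * (u : ℂ) ^ (ζ - 1))
      ((FT g (1 * ξ) / fhat0 θ (1 * ξ)) * ((1 : ℝ) : ℂ) ^ (ζ - 1)) 1 := by
    refine intervalIntegral.integral_hasDerivAt_right
      (intervalIntegrable_radial hβ hθ h0 hg hmom hζ ξ)
      (measurable_radial_integrand hβ hθ h0 hg ζ ξ).stronglyMeasurable.stronglyMeasurableAtFilter ?_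
    refine ((continuous_FT_div_fhat0 hβ hθ h0 hg).comp (continuous_mul_const ξ)).continuousAt.mul ?_
    exact ContinuousAt.cpow continuous_ofReal.continuousAt continuousAt_const (by simp)
  have h3 := h2.congr_of_eventuallyEq ((lt_mem_nhds (zero_lt_one' ℝ)).mono fun t ht =>
    cpow_mul_radial θ g ζ ξ ht)
  simpa using h1.unique h3

/-- The perturbed resolvent equation on the Fourier side. -/
def TransformedEq (θ : ℝ → ℂ) (ζ : ℂ) (f g : ℝ → ℂ) : Prop :=
  ∀ ξ : ℝ, (ζ + (ξ : ℂ) ^ 2 - FT θ ξ) * FT f ξ + ξ * FT (mulNegI f) ξ = FT g ξ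

theorem transformedEq_fsol (hβ : 0 < β) (hθ : ExpInt (β / 2) θ) (h0 : ∫ x : ℝ, θ x = 0)
    (hg : memE β g) (hmom : ∀ j < k, ∫ x : ℝ, g x * (x : ℂ) ^ j = 0) (hζ : -(k : ℝ) < ζ.re) :
    TransformedEq θ ζ (fsol θ g ζ) g := fun ξ => by
  have hf := memE_fsol hβ hθ h0 hg hmom hζ
  obtain ⟨d, hd, hd2⟩ := exists_hasDerivAt_fhat0 hβ hθ h0 ξ
  have hF := hasDerivAt_FT (memE.integrable hβ hf) (memE.integrable_mulNegI hβ hf) ξ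
  have hne := fhat0_ne_zero θ ξ
  have hrad : ∀ ξ, radial θ g ζ ξ = FT (fsol θ g ζ) ξ / fhat0 θ ξ := fun ξ => by
    rw [FT_fsol hβ hθ h0 hg hmom hζ, mul_div_cancel_left₀ _ (fhat0_ne_zero θ ξ), radial]
  have hQ := (hF.fun_div hd hne).congr_of_eventuallyEq (Filter.Eventually.of_forall hrad)
  have h := radial_ode hβ hθ h0 hg hmom hζ hQ
  rw [hrad] at h
  field_simp at h
  refine mul_left_cancel₀ hne ?_
  linear_combination h + FT (fsol θ g ζ) ξ * hd2

theorem TransformedEq.perturbedResolventEq (hβ : 0 < β) (hθ : Integrable θ) {f : ℝ → ℂ}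
    (hf : memE β f) (hg : memE β g) (h : TransformedEq θ ζ f g) :
    PerturbedResolventEq θ ζ f g := by
  intro φ hφ hc
  obtain ⟨ψ, hψ, hψ1, hψ2, rfl⟩ := exists_eq_FT hφ hc
  have hfi := memE.integrable hβ hf
  have hmi := memE.integrable_mulNegI hβ hf
  have hgi := memE.integrable hβ hg
  have e1 : deriv (FT ψ) = FT (mulNegI ψ) := by
    ext x; exact (hasDerivAt_FT hψ hψ1 x).deriv
  have e2 : deriv (FT (mulNegI ψ)) = FT (mulNegI (mulNegI ψ)) := by
    ext x; exact (hasDerivAt_FT hψ1 hψ2 x).deriv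
  have hbdd : ∀ {u v : ℝ → ℂ}, Integrable u → Integrable v → Integrable fun x => FT u x * v x :=
    fun {u v} hu hv => hv.bdd_mul (continuous_FT hu).aestronglyMeasurable
      (Filter.Eventually.of_forall fun x => norm_FT_le u x)
  have hbdd' : ∀ {u v : ℝ → ℂ}, Integrable u → Integrable v → Integrable fun x => u x * FT v x :=
    fun {u v} hu hv => (hbdd hv hu).congr (Filter.Eventually.of_forall fun x => mul_comm _ _)
  have e3 : ∫ x : ℝ, f x * (FT (mulNegI (mulNegI ψ)) x - x * FT (mulNegI ψ) x)
      = (∫ ξ : ℝ, FT f ξ * mulNegI (mulNegI ψ) ξ) - I * ∫ ξ : ℝ, FT (mulNegI f) ξ * mulNegI ψ ξ := by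
    rw [← integral_mul_FT hfi hψ2, ← integral_mul_FT hmi hψ1, ← integral_const_mul,
      ← integral_sub (hbdd' hfi hψ2) ((hbdd' hmi hψ1).const_mul I)]
    congr 1; ext x
    simp only [mulNegI]
    linear_combination -(x * f x * FT (mulNegI ψ) x) * I_sq
  have hi2 : Integrable fun ξ =>
      FT f ξ * mulNegI (mulNegI ψ) ξ - I * (FT (mulNegI f) ξ * mulNegI ψ ξ) :=
    (hbdd hfi hψ2).sub ((hbdd hmi hψ1).const_mul I)
  have hi3 : Integrable fun ξ => ζ * (FT f ξ * ψ ξ) -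
      (FT f ξ * mulNegI (mulNegI ψ) ξ - I * (FT (mulNegI f) ξ * mulNegI ψ ξ)) :=
    ((hbdd hfi hψ).const_mul ζ).sub hi2
  rw [e1, e2, e3, integral_mul_FT hfi hψ, integral_mul_FT (integrable_conv hθ hfi) hψ,
    integral_mul_FT hgi hψ, ← integral_const_mul, ← integral_const_mul,
    ← integral_sub (hbdd hfi hψ2) ((hbdd hmi hψ1).const_mul I),
    ← integral_sub ((hbdd hfi hψ).const_mul ζ) hi2,
    ← integral_sub hi3 (hbdd (integrable_conv hθ hfi) hψ)]
  congr 1; ext ξ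
  rw [← h ξ, FT_conv hθ hfi]
  simp only [mulNegI]
  linear_combination (-(ξ : ℂ) ^ 2 * FT f ξ * ψ ξ - ξ * FT (mulNegI f) ξ * ψ ξ) * I_sq

end

section

open scoped ENNReal Topology

variable {β : ℝ} {θ g : ℝ → ℂ} {ζ : ℂ} {k : ℕ}

theorem exists_cutoff : ∃ χ : ℝ → ℂ, ContDiff ℝ ∞ χ ∧ HasCompactSupport χ ∧ χ 0 = 1 := by
  let b : ContDiffBump (0 : ℝ) := default
  refine ⟨fun x => (b x : ℂ), ofRealCLM.contDiff.comp b.contDiff, ?_, ?_⟩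
  · exact b.hasCompactSupport.comp_left (g := fun x : ℝ => (x : ℂ)) (by simp)
  · simp [b.one_of_mem_closedBall (Metric.mem_closedBall_self b.rIn_pos.le)]

theorem tendsto_integral_mul_of_bounded {u : ℝ → ℂ} (hu : Integrable u) {F : ℕ → ℝ → ℂ}
    {G : ℝ → ℂ} (hF : ∀ n, Continuous (F n)) {C : ℝ} (hC : ∀ n x, ‖F n x‖ ≤ C)
    (hlim : ∀ x, Filter.Tendsto (fun n => F n x) Filter.atTop (𝓝 (G x))) :
    Filter.Tendsto (fun n => ∫ x : ℝ, u x * F n x) Filter.atTop (𝓝 (∫ x : ℝ, u x * G x)) := by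
  refine tendsto_integral_of_dominated_convergence (fun x => ‖u x‖ * C)
    (fun n => hu.aestronglyMeasurable.mul (hF n).aestronglyMeasurable) (hu.norm.mul_const C)
    (fun n => Filter.Eventually.of_forall fun x => ?_)
    (Filter.Eventually.of_forall fun x => (hlim x).const_mul _)
  rw [norm_mul]
  exact mul_le_mul_of_nonneg_left (hC n x) (norm_nonneg _)

theorem hasDerivAt_kernel_real (ξ x : ℝ) :
    HasDerivAt (fun x : ℝ => Complex.exp (-(I * x * ξ)))
      (-(I * ξ) * Complex.exp (-(I * x * ξ))) x := by
  have h1 : HasDerivAt (fun x : ℝ => -(I * (x : ℂ) * ξ)) (-(I * 1 * ξ)) x :=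
    (((hasDerivAt_id x).ofReal_comp.const_mul I).mul_const (ξ : ℂ)).neg
  refine h1.cexp.congr_deriv ?_
  ring

theorem hasDerivAt_dilate_mul_kernel {χ : ℝ → ℂ} (hχ : Differentiable ℝ χ) (r ξ x : ℝ) :
    HasDerivAt (fun x : ℝ => χ (x * r) * Complex.exp (-(I * x * ξ)))
      ((r * deriv χ (x * r) + -(I * ξ) * χ (x * r)) * Complex.exp (-(I * x * ξ))) x := by
  have h1 : HasDerivAt (fun x : ℝ => χ (x * r)) (r • deriv χ (x * r)) x := by
    have := (hχ (x * r)).hasDerivAt.scomp x ((hasDerivAt_id x).mul_const r)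
    simpa [Function.comp_def] using this
  refine (h1.fun_mul (hasDerivAt_kernel_real ξ x)).congr_deriv ?_
  rw [real_smul]
  ring

theorem PerturbedResolventEq.transformedEq (hβ : 0 < β) (hθ : Integrable θ) {f : ℝ → ℂ}
    (hf : memE β f) (hg : memE β g) (h : PerturbedResolventEq θ ζ f g) :
    TransformedEq θ ζ f g := fun ξ => by
  obtain ⟨χ, hχ, hχc, hχ0⟩ := exists_cutoff
  have hχ1 : ContDiff ℝ ∞ (deriv χ) := ((contDiff_infty_iff_deriv (𝕜 := ℝ)).1 hχ).2
  have hχ2 : ContDiff ℝ ∞ (deriv (deriv χ)) := ((contDiff_infty_iff_deriv (𝕜 := ℝ)).1 hχ1).2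
  obtain ⟨M0, hM0⟩ := hχ.continuous.bounded_above_of_compact_support hχc
  obtain ⟨M1, hM1⟩ := hχ1.continuous.bounded_above_of_compact_support hχc.deriv
  obtain ⟨M2, hM2⟩ := hχ2.continuous.bounded_above_of_compact_support hχc.deriv.deriv
  have hfi := memE.integrable hβ hf
  have hmi := memE.integrable_mulNegI hβ hf
  have hgi := memE.integrable hβ hg
  have hci := integrable_conv hθ hfi
  set e : ℝ → ℂ := fun x => Complex.exp (-(I * x * ξ)) with he
  have hen : ∀ x, ‖e x‖ = 1 := fun x => norm_kernel_real x ξ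
  have hec : Continuous e := by fun_prop
  have hes : ContDiff ℝ ∞ e := by
    have : ContDiff ℝ ∞ fun x : ℝ => (x : ℂ) := ofRealCLM.contDiff
    fun_prop
  let r : ℕ → ℝ := fun n => 1 / ((n : ℝ) + 1)
  have hr : Filter.Tendsto r Filter.atTop (𝓝 0) := tendsto_one_div_add_atTop_nhds_zero_nat
  have hr0 : ∀ n, 0 < r n := fun n => by positivity
  have hr1 : ∀ n, r n ≤ 1 := fun n => by
    rw [div_le_one (by positivity)]; linarith [n.cast_nonneg (α := ℝ)]
  have hrn : ∀ n, ‖(r n : ℂ)‖ ≤ 1 := fun n => by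
    rw [norm_real, Real.norm_of_nonneg (hr0 n).le]; exact hr1 n
  have hrc : Filter.Tendsto (fun n => (r n : ℂ)) Filter.atTop (𝓝 0) := by
    simpa [Function.comp_def] using (continuous_ofReal.tendsto 0).comp hr
  have hdil : ∀ {u : ℝ → ℂ}, Continuous u → ∀ x,
      Filter.Tendsto (fun n => u (x * r n)) Filter.atTop (𝓝 (u 0)) := fun {u} hu x => by
    have := hr.const_mul x
    rw [mul_zero] at this
    exact (hu.tendsto 0).comp this
  set b : ℂ := -(I * ξ) with hb
  let φ : ℕ → ℝ → ℂ := fun n x => χ (x * r n) * e x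
  let φ1 : ℕ → ℝ → ℂ := fun n x => (r n * deriv χ (x * r n) + b * χ (x * r n)) * e x
  let φ2 : ℕ → ℝ → ℂ := fun n x =>
    (r n * (r n * deriv (deriv χ) (x * r n) + b * deriv χ (x * r n))
      + b * (r n * deriv χ (x * r n) + b * χ (x * r n))) * e x
  have hd1 : ∀ n, deriv (φ n) = φ1 n := fun n => by
    ext x
    exact (hasDerivAt_dilate_mul_kernel (hχ.differentiable (by simp)) (r n) ξ x).deriv
  have hd2 : ∀ n, deriv (φ1 n) = φ2 n := fun n => by
    ext x
    have h1 := hasDerivAt_dilate_mul_kernel (hχ.differentiable (by simp)) (r n) ξ x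
    have h2 := hasDerivAt_dilate_mul_kernel (hχ1.differentiable (by simp)) (r n) ξ x
    have h3 := (h2.const_mul (r n : ℂ)).fun_add (h1.const_mul b)
    refine (h3.congr_deriv ?_ |>.congr_of_eventuallyEq
      (Filter.Eventually.of_forall fun y => ?_)).deriv
    · simp only [φ2, he, hb]; ring
    · simp only [φ1, he, hb]; ring
  have hφs : ∀ n, ContDiff ℝ ∞ (φ n) := fun n =>
    (hχ.comp (contDiff_id.mul contDiff_const)).mul hes
  have hφc : ∀ n, HasCompactSupport (φ n) := fun n => by
    have h1 : HasCompactSupport fun x => χ (x * r n) :=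
      hχc.comp_homeomorph (Homeomorph.mulRight₀ (r n) (hr0 n).ne')
    exact h1.mul_right
  have hc0 := hχ.continuous
  have hc1 := hχ1.continuous
  have hc2 := hχ2.continuous
  have hφ0c : ∀ n, Continuous (φ n) := fun n => (hφs n).continuous
  have hφ1c : ∀ n, Continuous (φ1 n) := fun n => by fun_prop
  have hφ2c : ∀ n, Continuous (φ2 n) := fun n => by fun_prop
  have hM0' : 0 ≤ M0 := (norm_nonneg _).trans (hM0 0)
  have hM1' : 0 ≤ M1 := (norm_nonneg _).trans (hM1 0)
  have hM2' : 0 ≤ M2 := (norm_nonneg _).trans (hM2 0)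
  have hstep : ∀ {a c : ℂ} {A C : ℝ}, ‖a‖ ≤ A → ‖c‖ ≤ C → ∀ n,
      ‖r n * a + b * c‖ ≤ A + ‖b‖ * C := fun {a c A C} ha hc' n => by
    refine (norm_add_le _ _).trans (add_le_add ?_ ?_)
    · rw [norm_mul]
      exact (mul_le_of_le_one_left (norm_nonneg _) (hrn n)).trans ha
    · rw [norm_mul]; gcongr
  have hB0 : ∀ n x, ‖φ n x‖ ≤ M0 := fun n x => by
    simpa only [φ, norm_mul, hen, mul_one] using hM0 _
  have hB1 : ∀ n x, ‖φ1 n x‖ ≤ M1 + ‖b‖ * M0 := fun n x => by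
    simpa only [φ1, norm_mul, hen, mul_one] using hstep (hM1 _) (hM0 _) n
  have hB2 : ∀ n x, ‖φ2 n x‖ ≤ (M2 + ‖b‖ * M1) + ‖b‖ * (M1 + ‖b‖ * M0) := fun n x => by
    simpa only [φ2, norm_mul, hen, mul_one] using
      hstep (hstep (hM2 _) (hM1 _) n) (hstep (hM1 _) (hM0 _) n) n
  have hL0 : ∀ x, Filter.Tendsto (fun n => φ n x) Filter.atTop (𝓝 (e x)) := fun x => by
    simpa [hχ0] using (hdil hc0 x).mul_const (e x)
  have hL1 : ∀ x, Filter.Tendsto (fun n => φ1 n x) Filter.atTop (𝓝 (b * e x)) := fun x => by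
    simpa [hχ0] using ((hrc.mul (hdil hc1 x)).add ((hdil hc0 x).const_mul b)).mul_const (e x)
  have hL2 : ∀ x, Filter.Tendsto (fun n => φ2 n x) Filter.atTop (𝓝 (b * b * e x)) := fun x => by
    simpa [hχ0] using ((hrc.mul ((hrc.mul (hdil hc2 x)).add ((hdil hc1 x).const_mul b))).add
      (((hrc.mul (hdil hc1 x)).add ((hdil hc0 x).const_mul b)).const_mul b)).mul_const (e x)
  have hint : ∀ {u v : ℝ → ℂ} {C : ℝ}, Integrable u → Continuous v → (∀ x, ‖v x‖ ≤ C) →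
      Integrable fun x => u x * v x := fun hu hv hC =>
    hu.mul_bdd hv.aestronglyMeasurable (Filter.Eventually.of_forall hC)
  have heq : ∀ n, ζ * (∫ x : ℝ, f x * φ n x) - ((∫ x : ℝ, f x * φ2 n x)
      - I * ∫ x : ℝ, mulNegI f x * φ1 n x) - (∫ x : ℝ, conv θ f x * φ n x)
        = ∫ x : ℝ, g x * φ n x := fun n => by
    have := h (φ n) (hφs n) (hφc n)
    rw [hd1, hd2] at this
    rw [← this, ← integral_const_mul I, ← integral_sub (hint hfi (hφ2c n) (hB2 n))
      ((hint hmi (hφ1c n) (hB1 n)).const_mul I)]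
    congr 3; ext x
    simp only [mulNegI]
    linear_combination (x * f x * φ1 n x) * I_sq
  have hlim := ((((tendsto_integral_mul_of_bounded hfi hφ0c hB0 hL0).const_mul ζ).sub
    ((tendsto_integral_mul_of_bounded hfi hφ2c hB2 hL2).sub
      ((tendsto_integral_mul_of_bounded hmi hφ1c hB1 hL1).const_mul I))).sub
    (tendsto_integral_mul_of_bounded hci hφ0c hB0 hL0))
  simp only [heq] at hlim
  have hfin := tendsto_nhds_unique (tendsto_integral_mul_of_bounded hgi hφ0c hB0 hL0) hlim
  have hpull : ∀ (u : ℝ → ℂ) (c : ℂ), ∫ x : ℝ, u x * (c * e x) = c * FT u ξ := fun u c => by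
    rw [FT, ← integral_const_mul]; congr 1; ext x; simp only [he]; ring
  rw [hpull, hpull] at hfin
  change FT g ξ = ζ * FT f ξ - (b * b * FT f ξ - I * (b * FT (mulNegI f) ξ))
    - FT (conv θ f) ξ at hfin
  rw [hfin, FT_conv hθ hfi, hb]
  linear_combination (ξ ^ 2 * FT f ξ + ξ * FT (mulNegI f) ξ) * I_sq

theorem TransformedEq.FT_eq (hβ : 0 < β) (hθ : ExpInt (β / 2) θ) (h0 : ∫ x : ℝ, θ x = 0)
    (hζ : -(k : ℝ) < ζ.re) {f₁ f₂ : ℝ → ℂ} (hf₁ : memE β f₁) (hf₂ : memE β f₂)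
    (hm₁ : ∀ j < k, ∫ x : ℝ, f₁ x * (x : ℂ) ^ j = 0)
    (hm₂ : ∀ j < k, ∫ x : ℝ, f₂ x * (x : ℂ) ^ j = 0)
    (h₁ : TransformedEq θ ζ f₁ g) (h₂ : TransformedEq θ ζ f₂ g) (ξ : ℝ) :
    FT f₁ ξ = FT f₂ ξ := by
  let Q : ℝ → ℂ := fun η => FT f₁ η / fhat0 θ η - FT f₂ η / fhat0 θ η
  have hQ : ∀ η, ∃ q : ℂ, HasDerivAt Q q η ∧ ζ * Q η + η * q = 0 := fun η => by
    obtain ⟨d, hd, hd2⟩ := exists_hasDerivAt_fhat0 hβ hθ h0 η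
    have hne := fhat0_ne_zero θ η
    have hF₁ := hasDerivAt_FT (memE.integrable hβ hf₁) (memE.integrable_mulNegI hβ hf₁) η
    have hF₂ := hasDerivAt_FT (memE.integrable hβ hf₂) (memE.integrable_mulNegI hβ hf₂) η
    refine ⟨_, (hF₁.fun_div hd hne).fun_sub (hF₂.fun_div hd hne), ?_⟩
    simp only [Q]
    field_simp
    linear_combination fhat0 θ η * (h₁ η - h₂ η) - (FT f₁ η - FT f₂ η) * hd2
  obtain ⟨C₁, hC₁, hb₁⟩ := exists_norm_FT_div_fhat0_le hβ hθ h0 hf₁ hm₁ |ξ|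
  obtain ⟨C₂, hC₂, hb₂⟩ := exists_norm_FT_div_fhat0_le hβ hθ h0 hf₂ hm₂ |ξ|
  let P : ℝ → ℂ := fun t => (t : ℂ) ^ ζ * Q (t * ξ)
  have hP : ∀ t ∈ Set.Ioi (0 : ℝ), HasDerivAt P 0 t := fun t ht => by
    obtain ⟨q, hq, hq2⟩ := hQ (t * ξ)
    have ht' : (t : ℂ) ≠ 0 := ofReal_ne_zero.2 (ne_of_gt ht)
    have e1 : HasDerivAt (fun t : ℝ => (t : ℂ) ^ ζ) (ζ * (t : ℂ) ^ (ζ - 1)) t := by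
      have := ((hasDerivAt_id (t : ℂ)).cpow_const (c := ζ)
        (Or.inl (by simpa using ht))).comp_ofReal
      simpa using this
    have e2 : HasDerivAt (fun t : ℝ => Q (t * ξ)) (ξ • q) t := by
      have := hq.scomp t ((hasDerivAt_id t).mul_const ξ)
      simpa [Function.comp_def] using this
    refine (e1.fun_mul e2).congr_deriv ?_
    rw [cpow_sub _ _ ht', cpow_one, real_smul]
    rw [ofReal_mul] at hq2
    field_simp
    linear_combination (t : ℂ) ^ ζ * hq2
  have hconst : ∀ t ∈ Set.Ioc (0 : ℝ) 1, P t = P 1 := fun t ht =>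
    isOpen_Ioi.is_const_of_deriv_eq_zero isPreconnected_Ioi
      (fun s hs => (hP s hs).differentiableAt.differentiableWithinAt)
      (fun s hs => (hP s hs).deriv) ht.1 (Set.mem_Ioi.2 one_pos)
  have hbound : ∀ t ∈ Set.Ioc (0 : ℝ) 1,
      ‖P 1‖ ≤ (C₁ + C₂) * |ξ| ^ k * t ^ (ζ.re + k) := fun t ht => by
    have habs : |t * ξ| = t * |ξ| := by rw [abs_mul, abs_of_pos ht.1]
    have hle : |t * ξ| ≤ |ξ| := by
      rw [habs]; exact mul_le_of_le_one_left (abs_nonneg _) ht.2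
    have h3 := (norm_sub_le _ _).trans (add_le_add (hb₁ _ hle) (hb₂ _ hle))
    rw [habs, mul_pow] at h3
    rw [← hconst t ht, norm_mul, norm_cpow_eq_rpow_re_of_pos ht.1, Real.rpow_add ht.1,
      Real.rpow_natCast]
    have h4 := Real.rpow_nonneg ht.1.le ζ.re
    calc _ ≤ t ^ ζ.re * (C₁ * (t ^ k * |ξ| ^ k) + C₂ * (t ^ k * |ξ| ^ k)) := by gcongr
      _ = _ := by ring
  have hpos : 0 < ζ.re + k := by linarith
  have hlim : Filter.Tendsto (fun t : ℝ => (C₁ + C₂) * |ξ| ^ k * t ^ (ζ.re + k)) (𝓝[>] 0)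
      (𝓝 0) := by
    have := ((Real.continuousAt_rpow_const 0 _ (Or.inr hpos.le)).tendsto.const_mul
      ((C₁ + C₂) * |ξ| ^ k)).mono_left (nhdsWithin_le_nhds (s := Set.Ioi (0 : ℝ)))
    rwa [Real.zero_rpow hpos.ne', mul_zero] at this
  have hz : ‖P 1‖ ≤ 0 := ge_of_tendsto hlim
    (Filter.mem_of_superset (Ioc_mem_nhdsGT one_pos) hbound)
  have h5 : Q ξ = 0 := by simpa [P] using norm_le_zero_iff.1 hz
  exact (div_left_inj' (fhat0_ne_zero θ ξ)).1 (sub_eq_zero.1 h5)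

theorem memE.ae_eq_of_FT_eq (hβ : 0 < β) {f₁ f₂ : ℝ → ℂ} (hf₁ : memE β f₁) (hf₂ : memE β f₂)
    (h : ∀ ξ, FT f₁ ξ = FT f₂ ξ) : f₁ =ᵐ[volume] f₂ := by
  have hi₁ := memE.integrable hβ hf₁
  have hi₂ := memE.integrable hβ hf₂
  have hL : ∀ {f : ℝ → ℂ}, memE β f → MemLp f 2 := fun {f} hf => by
    simpa using memLp_mul_exp hf (c := 0) (by simp; positivity)
  have hz : ∀ ξ, FT (f₁ - f₂) ξ = 0 := fun ξ => by
    have := integral_sub (integrable_mul_kernel hi₁ ξ) (integrable_mul_kernel hi₂ ξ)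
    rw [FT]
    simp only [Pi.sub_apply, sub_mul]
    rw [this, sub_eq_zero]
    exact h ξ
  have h2 := lintegral_FT_sq (hi₁.sub hi₂) ((hL hf₁).sub (hL hf₂))
  simp only [hz] at h2
  have h3 : ∫⁻ x, ‖(f₁ - f₂) x‖ₑ ^ 2 = 0 := by
    simpa [Real.pi_pos.not_ge, eq_comm] using h2
  rw [lintegral_eq_zero_iff' ((hi₁.sub hi₂).aestronglyMeasurable.enorm.pow_const 2)] at h3
  filter_upwards [h3] with x hx
  simpa [sub_eq_zero] using hx

end

end PerturbedFP

open PerturbedFP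

/-- for `g ∈ ℰ_k` and `Re ζ > −k`, the resolvent equation
`ζf − 𝔏f − θ*f = g` has exactly one solution `f ∈ ℰ_k`, whose Fourier transform is
`f̂(ξ) = f̂₀(ξ) ∫_0^1 (ĝ(sξ)/f̂₀(sξ)) s^{ζ−1} ds`. -/
theorem perturbed_resolvent_formula (β : ℝ) (hβ : 0 < β) (θ θ' : ℝ → ℂ)
    (hθmeas : AEStronglyMeasurable θ volume)
    (hθ'meas : AEStronglyMeasurable θ' volume)
    (hderiv : IsDistribDeriv θ θ')
    (hθint : Integrable (fun x : ℝ => ‖θ x‖ * Real.exp (β * |x| / 2)))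
    (hθ'int : Integrable (fun x : ℝ => ‖θ' x‖ * Real.exp (β * |x| / 2)))
    (hθmass : ∫ x : ℝ, θ x = 0)
    (k : ℕ) (g : ℝ → ℂ) (hg : memE β g)
    (hgmom : ∀ j < k, ∫ x : ℝ, g x * (x : ℂ) ^ j = 0)
    (ζ : ℂ) (hζ : -(k : ℝ) < ζ.re) :
    ∃ f : ℝ → ℂ, memE β f ∧ (∀ j < k, ∫ x : ℝ, f x * (x : ℂ) ^ j = 0) ∧
      PerturbedResolventEq θ ζ f g ∧
      (∀ ξ : ℝ, FT f ξ =
        fhat0 θ ξ * ∫ s in (0:ℝ)..1, (FT g (s * ξ) / fhat0 θ (s * ξ)) * (s : ℂ) ^ (ζ - 1)) ∧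
      (∀ f' : ℝ → ℂ, memE β f' → (∀ j < k, ∫ x : ℝ, f' x * (x : ℂ) ^ j = 0) →
        PerturbedResolventEq θ ζ f' g → f' =ᵐ[volume] f) := by
  have hθ : ExpInt (β / 2) θ := ⟨hθmeas, by simpa only [mul_div_right_comm] using hθint⟩
  have hθi : Integrable θ := hθ.integrable (half_pos hβ).le
  have hf := memE_fsol hβ hθ hθmass hg hgmom hζ
  have hm := moments_fsol_eq_zero hβ hθ hθmass hg hgmom hζ
  have ht := transformedEq_fsol hβ hθ hθmass hg hgmom hζ
  exact ⟨fsol θ g ζ, hf, hm, ht.perturbedResolventEq hβ hθi hf hg,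
    FT_fsol hβ hθ hθmass hg hgmom hζ, fun f' hf' hm' he =>
      memE.ae_eq_of_FT_eq hβ hf' hf
        (TransformedEq.FT_eq hβ hθ hθmass hζ hf' hf hm' hm (he.transformedEq hβ hθi hf' hg) ht)⟩
end

section
/- Let X and 𝒳 be Hilbert spaces and ι : X → 𝒳 an injective continuous linear map with dense range. Let k ∈ ℕ and let ψ₀, …, ψ_{k−1} be continuous linear functionals on 𝒳 that are linearly independent. Then the closed subspace ⋂_{j=0}^{k−1} ker ψ_j of 𝒳 equals the closure in 𝒳 of the image under ι of ⋂_{j=0}^{k−1} ker(ψ_j ∘ ι). -/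
open Set

/-- If `f` has dense range, then `ker g` is the closure of `f (ker (g ∘ f))` for every continuous
linear map `g` into a finite-dimensional space. -/
theorem ker_eq_closure_image_ker_comp {𝕜 E F V : Type*}
    [NontriviallyNormedField 𝕜] [CompleteSpace 𝕜]
    [NormedAddCommGroup E] [NormedSpace 𝕜 E] [NormedAddCommGroup F] [NormedSpace 𝕜 F]
    [NormedAddCommGroup V] [NormedSpace 𝕜 V] [FiniteDimensional 𝕜 V]
    (f : E →L[𝕜] F) (hf : DenseRange f) (g : F →L[𝕜] V) :
    {y : F | g y = 0} = closure (f '' {x : E | g (f x) = 0}) := by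
  apply Subset.antisymm
  · let L : E →ₗ[𝕜] V := (g.comp f).toLinearMap
    obtain ⟨r, hr⟩ := L.rangeRestrict.exists_rightInverse_of_surjective L.range_rangeRestrict
    obtain ⟨s, hs⟩ := LinearMap.exists_extend r
    have hsL : ∀ v ∈ LinearMap.range L, g (f (s v)) = v := by
      intro v hv
      have h₁ : s v = r ⟨v, hv⟩ := LinearMap.congr_fun hs ⟨v, hv⟩
      have h₂ : L.rangeRestrict (r ⟨v, hv⟩) = ⟨v, hv⟩ := LinearMap.congr_fun hr ⟨v, hv⟩
      rw [h₁]
      exact congrArg Subtype.val h₂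
    have hcont : Continuous s := s.continuous_of_finiteDimensional
    have hP : Continuous fun y => y - f (s (g y)) := by fun_prop
    intro y hy
    have hy' : y - f (s (g y)) = y := by
      rw [show g y = 0 from hy]
      simp
    refine mem_of_eq_of_mem hy'.symm (map_mem_closure (f := fun y => y - f (s (g y))) hP (hf y) ?_)
    rintro _ ⟨x, rfl⟩
    refine ⟨x - s (g (f x)), ?_, by simp⟩
    have := hsL (g (f x)) ⟨x, rfl⟩
    simp [this]
  · refine closure_minimal ?_ (isClosed_eq g.continuous continuous_const)
    rintro _ ⟨x, hx, rfl⟩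
    exact hx

/-- let `X`, `𝒳` be Hilbert spaces, `ι : X → 𝒳` an injective continuous
linear map with dense range, and `ψ₀, …, ψ_{k−1}` linearly independent continuous
linear functionals on `𝒳`. Then `⋂_j ker ψ_j` equals the closure in `𝒳` of the image
under `ι` of `⋂_j ker (ψ_j ∘ ι)`. -/
theorem closure_of_kernels
    {𝕜 : Type*} [RCLike 𝕜]
    {X 𝒳 : Type*}
    [NormedAddCommGroup X] [InnerProductSpace 𝕜 X] [CompleteSpace X]
    [NormedAddCommGroup 𝒳] [InnerProductSpace 𝕜 𝒳] [CompleteSpace 𝒳]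
    (ι : X →L[𝕜] 𝒳) (hinj : Function.Injective ι) (hdense : DenseRange ι)
    (k : ℕ) (ψ : Fin k → (𝒳 →L[𝕜] 𝕜))
    (hind : LinearIndependent 𝕜 ψ) :
    {y : 𝒳 | ∀ j : Fin k, ψ j y = 0}
      = closure (ι '' {x : X | ∀ j : Fin k, ψ j (ι x) = 0}) := by
  simpa [funext_iff] using
    ker_eq_closure_image_ker_comp ι hdense (ContinuousLinearMap.pi ψ)
end
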